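/- arXiv:2108.12021 — 3 statements merged into one kernel-verified Lean document; each statement's English description precedes it below -/
import Mathlib

section
/- Let k be a field of characteristic zero and B a normal affine k-domain with dim_k B = 2 and B* = k*. If B admits a nontrivial fundamental pair (equivalently, a nontrivial SL₂(k)-action), then B is isomorphic as a k-algebra to one of the following: k[F_d] for some d ≥ 1; S_λ(k) = k[x_0,x_1,x_2]/(2x_0x_2 − x_1² − λ) for some λ ∈ k*; or Q_λ(k) for some λ ∈ k*. Among these rings, the unique factorization domains are exactly k[F_1] ≅ k^[2] and those S_λ(k) with λ ∈ k* such that −λ is not a square in k. -/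
/-- A derivation is locally nilpotent if every element is annihilated by some power. -/
def IsLND {R B : Type*} [CommRing R] [CommRing B] [Algebra R B]
    (D : Derivation R B B) : Prop :=
  ∀ b : B, ∃ n : ℕ, (D.toLinearMap ^ n) b = 0

/-- The degree-`d` piece `B_d = ker([D,U] - d·id)` of the `ℤ`-grading induced by `(D, U)`. -/
def gradePiece {R B : Type*} [CommRing R] [CommRing B] [Algebra R B]
    (D U : Derivation R B B) (d : ℤ) : Submodule R B :=
  LinearMap.ker ((⁅D, U⁆ : Derivation R B B).toLinearMap
    - d • (LinearMap.id : B →ₗ[R] B))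

/-- `(D, U)` is a fundamental pair: both are locally nilpotent, `[D,[D,U]] = -2D`,
`[U,[D,U]] = 2U`, and `B` is the sum of the eigenspaces of `[D,U]`. -/
def IsFundamentalPair {R B : Type*} [CommRing R] [CommRing B] [Algebra R B]
    (D U : Derivation R B B) : Prop :=
  IsLND D ∧ IsLND U ∧
    ⁅D, ⁅D, U⁆⁆ = (-2 : ℤ) • D ∧
    ⁅U, ⁅D, U⁆⁆ = (2 : ℤ) • U ∧
    (⨆ d : ℤ, gradePiece D U d) = ⊤

open MvPolynomial

/-- `k[F_d]`: the subalgebra of `k[y,z]` generated by the monomials `y^i z^(d-i)`. -/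
noncomputable def coneRNC (k : Type*) [Field k] (d : ℕ) :
    Subalgebra k (MvPolynomial (Fin 2) k) :=
  Algebra.adjoin k {m | ∃ i : ℕ, i ≤ d ∧ m = X 0 ^ i * X 1 ^ (d - i)}

/-- The ideal `(2x₀x₂ − x₁² − λ)` of `k[x₀,x₁,x₂]`. -/
noncomputable abbrev SIdeal (k : Type*) [Field k] (lam : k) : Ideal (MvPolynomial (Fin 3) k) :=
  Ideal.span {2 * X 0 * X 2 - X 1 ^ 2 - C lam}

/-- The smooth Danielewski surface ring `S_λ(k) = k[x₀,x₁,x₂]/(2x₀x₂ − x₁² − λ)`. -/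
noncomputable abbrev Slam (k : Type*) [Field k] (lam : k) :=
  MvPolynomial (Fin 3) k ⧸ SIdeal k lam

/-- `Q_λ(k)`: the subalgebra of `S_λ(k)` generated by the images of
`x₂², x₁x₂, 3x₀x₂ − λ, x₀x₁, x₀²`. -/
noncomputable def Qlam (k : Type*) [Field k] (lam : k) : Subalgebra k (Slam k lam) :=
  Algebra.adjoin k
    {Ideal.Quotient.mk (SIdeal k lam) (X 2 ^ 2),
     Ideal.Quotient.mk (SIdeal k lam) (X 1 * X 2),
     Ideal.Quotient.mk (SIdeal k lam) (3 * X 0 * X 2 - C lam),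
     Ideal.Quotient.mk (SIdeal k lam) (X 0 * X 1),
     Ideal.Quotient.mk (SIdeal k lam) (X 0 ^ 2)}

/-- A commutative ring is a UFD if it is a domain which is a unique factorization
monoid. -/
def IsUFDRing (R : Type*) [CommRing R] : Prop :=
  ∃ _h : IsDomain R, letI := _h; UniqueFactorizationMonoid R

section FundamentalPair

variable {k B : Type*} [Field k] [CommRing B] [Algebra k B]

/-- `b` is an eigenvector of `[D, U]` of weight `e`. -/
def IsWeight (D U : Derivation k B B) (e : ℤ) (b : B) : Prop :=
  ⁅D, U⁆ b = (e : B) * b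

theorem IsFundamentalPair.commutator_D {D U : Derivation k B B} (h : IsFundamentalPair D U)
    (b : B) : ⁅D, U⁆ (D b) = D (⁅D, U⁆ b) + 2 * D b := by
  have h1 := congrArg (fun X : Derivation k B B => X b) h.2.2.1
  simp only [Derivation.commutator_apply (D1 := D) (D2 := ⁅D, U⁆), Derivation.smul_apply] at h1
  rw [zsmul_eq_mul] at h1
  push_cast at h1
  linear_combination -h1

theorem IsFundamentalPair.commutator_U {D U : Derivation k B B} (h : IsFundamentalPair D U)
    (b : B) : ⁅D, U⁆ (U b) = U (⁅D, U⁆ b) - 2 * U b := by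
  have h1 := congrArg (fun X : Derivation k B B => X b) h.2.2.2.1
  simp only [Derivation.commutator_apply (D1 := U) (D2 := ⁅D, U⁆), Derivation.smul_apply] at h1
  rw [zsmul_eq_mul] at h1
  push_cast at h1
  linear_combination -h1

theorem IsWeight.map_D {D U : Derivation k B B} (h : IsFundamentalPair D U) {e : ℤ} {b : B}
    (hb : IsWeight D U e b) : IsWeight D U (e + 2) (D b) := by
  unfold IsWeight at *
  rw [h.commutator_D, hb]
  simp
  ring

theorem IsWeight.map_U {D U : Derivation k B B} (h : IsFundamentalPair D U) {e : ℤ} {b : B}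
    (hb : IsWeight D U e b) : IsWeight D U (e - 2) (U b) := by
  unfold IsWeight at *
  rw [h.commutator_U, hb]
  simp
  ring

theorem IsWeight.iterate_U {D U : Derivation k B B} (h : IsFundamentalPair D U) {e : ℤ} {b : B}
    (hb : IsWeight D U e b) (j : ℕ) : IsWeight D U (e - 2 * j) (U^[j] b) := by
  induction j with
  | zero => simpa using hb
  | succ j ih =>
    rw [Function.iterate_succ_apply']
    have := ih.map_U h
    convert this using 1
    push_cast
    ring

theorem IsWeight.mul {D U : Derivation k B B} {d e : ℤ} {a b : B}
    (ha : IsWeight D U d a) (hb : IsWeight D U e b) : IsWeight D U (d + e) (a * b) := by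
  unfold IsWeight at *
  rw [Derivation.leibniz, ha, hb]
  simp
  ring

theorem IsWeight.pow {D U : Derivation k B B} {d : ℤ} {a : B}
    (ha : IsWeight D U d a) (n : ℕ) : IsWeight D U (n * d) (a ^ n) := by
  induction n with
  | zero => simp [IsWeight]
  | succ n ih =>
    rw [pow_succ]
    convert ih.mul ha using 1
    push_cast
    ring

theorem IsWeight.add {D U : Derivation k B B} {d : ℤ} {a b : B}
    (ha : IsWeight D U d a) (hb : IsWeight D U d b) : IsWeight D U d (a + b) := by
  unfold IsWeight at *
  rw [map_add, ha, hb]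
  ring

theorem IsWeight.sub {D U : Derivation k B B} {d : ℤ} {a b : B}
    (ha : IsWeight D U d a) (hb : IsWeight D U d b) : IsWeight D U d (a - b) := by
  unfold IsWeight at *
  rw [map_sub, ha, hb]
  ring

theorem IsWeight.smul {D U : Derivation k B B} {d : ℤ} {a : B}
    (ha : IsWeight D U d a) (c : k) : IsWeight D U d (c • a) := by
  unfold IsWeight at *
  rw [Derivation.map_smul, ha, mul_smul_comm]

theorem D_iterate_U {D U : Derivation k B B} (h : IsFundamentalPair D U) {d : ℤ} {a : B}
    (hD : D a = 0) (ha : IsWeight D U d a) (j : ℕ) :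
    D (U^[j + 1] a) = ((j + 1) * (d - j) : ℤ) * U^[j] a := by
  induction j with
  | zero =>
    have h1 : ⁅D, U⁆ a = D (U a) - U (D a) := Derivation.commutator_apply ..
    rw [hD, map_zero, sub_zero, ha] at h1
    simp [← h1]
  | succ j ih =>
    have h1 : ⁅D, U⁆ (U^[j + 1] a) = D (U (U^[j + 1] a)) - U (D (U^[j + 1] a)) :=
      Derivation.commutator_apply ..
    rw [ha.iterate_U h (j + 1), ih, Derivation.leibniz, Derivation.map_intCast,
      ← Function.iterate_succ_apply' U, ← Function.iterate_succ_apply' U] at h1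
    simp only [smul_eq_mul, mul_zero, add_zero] at h1
    push_cast at h1 ⊢
    linear_combination -h1

theorem IsLND.exists_iterate {D : Derivation k B B} (h : IsLND D) (b : B) :
    ∃ n : ℕ, D^[n] b = 0 := by
  obtain ⟨n, hn⟩ := h b
  refine ⟨n, ?_⟩
  rw [Module.End.pow_apply] at hn
  exact hn

/-- The span of the vectors `U ^ j a` of weight `e`, where `a` is a highest weight vector. -/
def highestWeightSpan (D U : Derivation k B B) (e : ℤ) : Submodule k B :=
  Submodule.span k {m | ∃ (a : B) (d : ℤ) (j : ℕ), D a = 0 ∧ IsWeight D U d a ∧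
    d - 2 * j = e ∧ m = U^[j] a}

theorem isWeight_of_mem {D U : Derivation k B B} (h : IsFundamentalPair D U) {e : ℤ} {m : B}
    (hm : m ∈ highestWeightSpan D U e) : IsWeight D U e m := by
  induction hm using Submodule.span_induction with
  | mem x hx =>
    obtain ⟨a, d, j, hD, ha, rfl, rfl⟩ := hx
    exact ha.iterate_U h j
  | zero => simp [IsWeight]
  | add x y _ _ hx hy => exact hx.add hy
  | smul c x _ hx => exact hx.smul c

variable [CharZero k] [IsDomain B]

theorem highest_weight_nonneg {D U : Derivation k B B} (h : IsFundamentalPair D U) {d : ℤ} {a : B}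
    (hD : D a = 0) (ha : IsWeight D U d a) (h0 : a ≠ 0) :
    ∃ N : ℕ, d = N ∧ U^[N + 1] a = 0 ∧ ∀ j ≤ N, U^[j] a ≠ 0 := by
  classical
  have : CharZero B := charZero_of_injective_algebraMap (algebraMap k B).injective
  have hex := h.2.1.exists_iterate a
  have hpos : Nat.find hex ≠ 0 := by
    intro h1
    have := Nat.find_spec hex
    rw [h1] at this
    exact h0 this
  obtain ⟨N, hN⟩ := Nat.exists_eq_succ_of_ne_zero hpos
  have hs := Nat.find_spec hex
  rw [hN] at hs
  have hlt : ∀ j ≤ N, U^[j] a ≠ 0 := fun j hj => Nat.find_min hex (by omega)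
  refine ⟨N, ?_, hs, hlt⟩
  have h2 := D_iterate_U h hD ha N
  rw [Nat.succ_eq_add_one] at hs
  rw [hs, map_zero] at h2
  have h3 := (mul_eq_zero.1 h2.symm).resolve_right (hlt N le_rfl)
  have h4 := Int.cast_eq_zero.1 h3
  have h5 := (mul_eq_zero.1 h4).resolve_left (by positivity)
  omega

/-- A vector of negative weight `e` with `U (D b) = 0` vanishes. -/
theorem eq_zero_of_U_D_eq_zero {D U : Derivation k B B} (h : IsFundamentalPair D U) {e : ℤ} {b : B}
    (hb : IsWeight D U e b) (he : e < 0) (hUD : U (D b) = 0) : b = 0 := by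
  have : CharZero B := charZero_of_injective_algebraMap (algebraMap k B).injective
  have key : ∀ i : ℕ, D (U^[i + 1] b) = ((i + 1) * (e - i) : ℤ) * U^[i] b := by
    intro i
    induction i with
    | zero =>
      have h1 : ⁅D, U⁆ b = D (U b) - U (D b) := Derivation.commutator_apply ..
      rw [hUD, sub_zero, hb] at h1
      simp [← h1]
    | succ j ih =>
      have h1 : ⁅D, U⁆ (U^[j + 1] b) = D (U (U^[j + 1] b)) - U (D (U^[j + 1] b)) :=
        Derivation.commutator_apply ..
      rw [hb.iterate_U h (j + 1), ih, Derivation.leibniz, Derivation.map_intCast,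
        ← Function.iterate_succ_apply' U, ← Function.iterate_succ_apply' U] at h1
      simp only [smul_eq_mul, mul_zero, add_zero] at h1
      push_cast at h1 ⊢
      linear_combination -h1
  obtain ⟨N, hN⟩ := h.2.1.exists_iterate b
  induction N with
  | zero => exact hN
  | succ N ih =>
    refine ih ?_
    have h2 := key N
    rw [hN, map_zero] at h2
    refine (mul_eq_zero.1 h2.symm).resolve_left ?_
    exact Int.cast_ne_zero.2 (mul_ne_zero (by positivity) (by omega))

theorem exists_D_add_of_mem {D U : Derivation k B B} (h : IsFundamentalPair D U) {e : ℤ} {m : B}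
    (hm : m ∈ highestWeightSpan D U (e + 2)) :
    ∃ b' ∈ highestWeightSpan D U e, ∃ r, m = D b' + r ∧ U r = 0 ∧ (e < 0 ∨ r = 0) := by
  induction hm using Submodule.span_induction with
  | mem x hx =>
    obtain ⟨a, d, j, hD, ha, hd, rfl⟩ := hx
    by_cases h0 : a = 0
    · exact ⟨0, zero_mem _, 0, by simp [h0, iterate_map_zero], by simp, Or.inr rfl⟩
    obtain ⟨N, rfl, hN, hlt⟩ := highest_weight_nonneg h hD ha h0
    rcases lt_trichotomy j N with hj | hj | hj
    · have hc : (((j + 1) * (N - j) : ℤ) : k) ≠ 0 := by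
        rw [Int.cast_ne_zero]
        exact mul_ne_zero (by positivity) (by omega)
      refine ⟨(((j + 1) * (N - j) : ℤ) : k)⁻¹ • U^[j + 1] a, ?_, 0, ?_, by simp, Or.inr rfl⟩
      · refine Submodule.smul_mem _ _ (Submodule.subset_span ⟨a, N, j + 1, hD, ha, ?_, rfl⟩)
        push_cast
        omega
      · rw [Derivation.map_smul, D_iterate_U h hD ha j, add_zero]
        have : ((((j + 1) * ((N : ℤ) - j) : ℤ)) : B)
            = algebraMap k B (((j + 1) * ((N : ℤ) - j) : ℤ) : k) := by
          rw [map_intCast]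
        rw [this, ← Algebra.smul_def, smul_smul, inv_mul_cancel₀ hc, one_smul]
    · refine ⟨0, zero_mem _, U^[j] a, by simp, ?_, Or.inl (by omega)⟩
      rw [← Function.iterate_succ_apply' U, hj]
      exact hN
    · refine ⟨0, zero_mem _, 0, ?_, by simp, Or.inr rfl⟩
      obtain ⟨i, rfl⟩ := Nat.exists_eq_add_of_lt hj
      rw [show N + i + 1 = i + (N + 1) by ring, Function.iterate_add_apply, hN]
      simp [iterate_map_zero]
  | zero => exact ⟨0, zero_mem _, 0, by simp, by simp, Or.inr rfl⟩
  | add x y _ _ hx hy =>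
    obtain ⟨b, hb, r, rfl, hr, hr'⟩ := hx
    obtain ⟨c, hc, s, rfl, hs, hs'⟩ := hy
    refine ⟨b + c, add_mem hb hc, r + s, by rw [map_add]; ring, by rw [map_add, hr, hs, add_zero],
      ?_⟩
    rcases hr' with hr' | rfl
    · exact Or.inl hr'
    · rcases hs' with hs' | rfl
      · exact Or.inl hs'
      · exact Or.inr (by simp)
  | smul c x _ hx =>
    obtain ⟨b, hb, r, rfl, hr, hr'⟩ := hx
    refine ⟨c • b, Submodule.smul_mem _ _ hb, c • r, by rw [Derivation.map_smul, smul_add],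
      by rw [Derivation.map_smul, hr, smul_zero], hr'.imp_right fun h => by rw [h, smul_zero]⟩

theorem mem_highestWeightSpan {D U : Derivation k B B} (h : IsFundamentalPair D U) (N : ℕ) :
    ∀ {e : ℤ} {b : B}, IsWeight D U e b → D^[N] b = 0 → b ∈ highestWeightSpan D U e := by
  induction N with
  | zero =>
    intro e b _ hN
    have : b = 0 := hN
    rw [this]
    exact zero_mem _
  | succ N ih =>
    intro e b hb hN
    obtain ⟨b', hb', r, h1, h2, h3⟩ := exists_D_add_of_mem h (ih (hb.map_D h) hN)
    have h4 : D (b - b') = r := by rw [map_sub, h1]; ring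
    rcases h3 with h3 | rfl
    · have h5 : b - b' = 0 :=
        eq_zero_of_U_D_eq_zero h (hb.sub (isWeight_of_mem h hb')) h3 (by rw [h4, h2])
      rwa [sub_eq_zero.1 h5]
    · have h6 : b - b' ∈ highestWeightSpan D U e :=
        Submodule.subset_span ⟨b - b', e, 0, h4, hb.sub (isWeight_of_mem h hb'), by simp, rfl⟩
      simpa using add_mem h6 hb'

/-- A submodule containing all `U ^ j a`, with `a` a highest weight vector, is everything. -/
theorem eq_top_of_iterate_U_mem {D U : Derivation k B B} (h : IsFundamentalPair D U)
    (S : Submodule k B)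
    (hS : ∀ (a : B) (d : ℤ) (j : ℕ), D a = 0 → IsWeight D U d a → U^[j] a ∈ S) : S = ⊤ := by
  rw [eq_top_iff, ← h.2.2.2.2, iSup_le_iff]
  intro e b hb
  obtain ⟨N, hN⟩ := h.1.exists_iterate b
  have hb' : IsWeight D U e b := by
    have : ⁅D, U⁆ b - e • b = 0 := hb
    rw [zsmul_eq_mul] at this
    exact sub_eq_zero.1 this
  refine Submodule.span_le.2 ?_ (mem_highestWeightSpan h N hb' hN)
  rintro _ ⟨a, d, j, hD, ha, _, rfl⟩
  exact hS a d j hD ha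

end FundamentalPair

section TranscendenceDegree

theorem ringKrullDim_le_of_isIntegral {R S : Type*} [CommRing R] [CommRing S] [Algebra R S]
    [Algebra.IsIntegral R S] [FaithfulSMul R S] : ringKrullDim R ≤ ringKrullDim S := by
  refine iSup_le fun l => ?_
  obtain ⟨P, hP, hPl⟩ := Ideal.exists_ideal_over_prime_of_isIntegral (S := S) l.head.asIdeal ⊥
    (by
      intro x hx
      have hx' : algebraMap R S x = 0 := hx
      rw [(FaithfulSMul.algebraMap_injective R S) (hx'.trans (map_zero _).symm)]
      exact zero_mem _)
  have : P.LiesOver l.head.asIdeal := ⟨hPl.2.symm⟩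
  have := hPl.1
  obtain ⟨L, hL, -⟩ := Ideal.exists_ltSeries_of_hasGoingUp l P
  rw [← hL]
  exact le_iSup (fun L : LTSeries (PrimeSpectrum S) => (L.length : WithBot ℕ∞)) L

theorem trdeg_le_of_ringKrullDim_eq {k B : Type*} [Field k] [CommRing B] [IsDomain B] [Algebra k B]
    [Algebra.FiniteType k B] {n : ℕ} (hdim : ringKrullDim B = n) : Algebra.trdeg k B ≤ n := by
  obtain ⟨s, g, hg, hint⟩ := exists_integral_inj_algHom_of_fg k B
  algebraize [g.toRingHom]
  have : FaithfulSMul (MvPolynomial (Fin s) k) B := (faithfulSMul_iff_algebraMap_injective _ _).2 hg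
  have h1 := ringKrullDim_le_of_isIntegral (R := MvPolynomial (Fin s) k) (S := B)
  rw [hdim, MvPolynomial.ringKrullDim_of_isNoetherianRing, ringKrullDim_eq_zero_of_field] at h1
  have h2 : s ≤ n := by
    simp at h1
    exact_mod_cast h1
  have : IsScalarTower k (MvPolynomial (Fin s) k) B := IsScalarTower.of_algHom g
  have h3 := lift_trdeg_add_eq k (MvPolynomial (Fin s) k) B
  have : Algebra.IsAlgebraic (MvPolynomial (Fin s) k) B := inferInstance
  rw [trdeg_eq_zero (R := MvPolynomial (Fin s) k), MvPolynomial.trdeg_of_isDomain] at h3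
  simp at h3
  have h4 : Algebra.trdeg k B = s := by
    simpa using h3.symm
  rw [h4]
  exact_mod_cast h2

theorem trdeg_fractionRing {k B : Type*} [Field k] [CommRing B] [IsDomain B] [Algebra k B] :
    Algebra.trdeg k (FractionRing B) = Algebra.trdeg k B := by
  have h3 := trdeg_add_eq k B (A := FractionRing B)
  have : Algebra.IsAlgebraic B (FractionRing B) :=
    IsLocalization.isAlgebraic (S := FractionRing B) (R := B) (nonZeroDivisors B)
  rw [trdeg_eq_zero (R := B), add_zero] at h3
  exact h3.symm

theorem Derivation.eq_zero_of_isAlgebraic {k K : Type*} [Field k] [CharZero k] [Field K]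
    [Algebra k K] (δ : Derivation k K K) (S : Subalgebra k K) (hS : ∀ x ∈ S, δ x = 0) {y : K}
    (hy : IsAlgebraic S y) : δ y = 0 := by
  have : CharZero K := charZero_of_injective_algebraMap (algebraMap k K).injective
  have : CharZero S := charZero_of_injective_algebraMap (algebraMap k S).injective
  let δ' : Derivation S K K := Derivation.mk'
    { toFun := δ
      map_add' := map_add δ
      map_smul' := fun c x => by
        change δ ((c : K) * x) = (c : K) * δ x
        rw [Derivation.leibniz, hS c c.2]
        simp } (fun a b => δ.leibniz a b)
  have key : ∀ n : ℕ, ∀ p : Polynomial S, p.natDegree ≤ n → p ≠ 0 → Polynomial.aeval y p = 0 →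
      δ y = 0 := by
    intro n
    induction n with
    | zero =>
      intro p hp h0 hy
      rw [Polynomial.eq_C_of_natDegree_le_zero hp, Polynomial.aeval_C] at hy
      have hc : p.coeff 0 = 0 := Subtype.val_injective hy
      refine absurd ?_ h0
      rw [Polynomial.eq_C_of_natDegree_le_zero hp, hc, map_zero]
    | succ n ih =>
      intro p hp h0 hy
      have h1 : δ' (Polynomial.aeval y p) = Polynomial.aeval y (Polynomial.derivative p) • δ' y :=
        δ'.map_aeval p y
      rw [hy, map_zero, smul_eq_mul] at h1
      rcases mul_eq_zero.1 h1.symm with h2 | h2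
      · by_cases h3 : Polynomial.derivative p = 0
        · refine ih p ?_ h0 hy
          rw [Polynomial.derivative_eq_zero.1 h3]
          exact Nat.zero_le _
        · refine ih _ ?_ h3 h2
          exact (Polynomial.natDegree_derivative_le p).trans (by omega)
      · exact h2
  obtain ⟨p, hp, hy⟩ := hy
  exact key _ p le_rfl hp hy

theorem Derivation.eq_zero_of_mem_adjoin {k K : Type*} [CommRing k] [CommRing K] [Algebra k K]
    (δ : Derivation k K K) {s : Set K} (hs : ∀ x ∈ s, δ x = 0) {x : K}
    (hx : x ∈ Algebra.adjoin k s) : δ x = 0 := by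
  induction hx using Algebra.adjoin_induction with
  | mem x hx => exact hs x hx
  | algebraMap r => exact δ.map_algebraMap r
  | add x y _ _ hx hy => rw [map_add, hx, hy, add_zero]
  | mul x y _ _ hx hy => rw [δ.leibniz, hx, hy, smul_zero, smul_zero, add_zero]

/-- Two derivations with a common constant `t` and triangular values bound the transcendence
degree from below. -/
theorem isAlgebraic_of_derivations {k K : Type*} [Field k] [CharZero k] [Field K] [Algebra k K]
    (htr : Algebra.trdeg k K ≤ 2) (D E : Derivation k K K) {t h p : K} (hDt : D t = 0)
    (hEt : E t = 0) (hDh : D h = 0) (hEh : E h ≠ 0) (hDp : D p ≠ 0) : IsAlgebraic k t := by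
  by_contra ht
  have h1 : AlgebraicIndependent k (fun _ : Unit => t) :=
    (algebraicIndependent_singleton_iff ()).2 ht
  have h2 := (h1.option_iff_transcendental h).2 (fun ha => hEh
    (E.eq_zero_of_isAlgebraic _ (fun x hx => E.eq_zero_of_mem_adjoin (by simp [hEt]) hx) ha))
  have h3 := (h2.option_iff_transcendental p).2 (fun ha => hDp
    (D.eq_zero_of_isAlgebraic _ (fun x hx => D.eq_zero_of_mem_adjoin (by
      rintro _ ⟨_ | _, rfl⟩
      · exact hDh
      · exact hDt) hx) ha))
  have h4 := h3.lift_cardinalMk_le_trdeg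
  have h5 := h4.trans (Cardinal.lift_le.2 htr)
  simp at h5
  norm_num at h5

open TensorProduct in
theorem Derivation.exists_extend_fractionRing {k B : Type*} [Field k] [CommRing B] [IsDomain B]
    [Algebra k B] (D : Derivation k B B) :
    ∃ D' : Derivation k (FractionRing B) (FractionRing B),
      ∀ b, D' (algebraMap B (FractionRing B) b) = algebraMap B (FractionRing B) (D b) := by
  let K := FractionRing B
  have : Algebra.FormallyEtale B K := Algebra.FormallyEtale.of_isLocalization (nonZeroDivisors B)
  let f : Ω[B⁄k] →ₗ[B] K := (Algebra.linearMap B K).comp D.liftKaehlerDifferential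
  let g : K ⊗[B] Ω[B⁄k] →ₗ[K] K := f.liftBaseChange K
  let e := KaehlerDifferential.tensorKaehlerEquivOfFormallyEtale k B K
  refine ⟨(g.comp e.symm.toLinearMap).compDer (KaehlerDifferential.D k K), fun b => ?_⟩
  have h1 : e.symm (KaehlerDifferential.D k K (algebraMap B K b)) =
      1 ⊗ₜ KaehlerDifferential.D k B b :=
    KaehlerDifferential.tensorKaehlerEquivOfFormallyEtale_symm_D_algebraMap k B K b
  change g (e.symm (KaehlerDifferential.D k K (algebraMap B K b))) = _
  rw [h1]
  simp [g, f]
  rfl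

end TranscendenceDegree

section HighestWeight

variable {k B : Type*} [Field k] [CommRing B] [IsDomain B] [Algebra k B]

theorem exists_algebraMap_eq_of_isAlgebraic [IsIntegrallyClosed B]
    (hunits : ∀ b : Bˣ, ∃ c : kˣ, (b : B) = algebraMap k B (c : k)) {t : FractionRing B}
    (ht : IsAlgebraic k t) : ∃ c : k, t = algebraMap k (FractionRing B) c := by
  have h1 : IsIntegral B t := ht.isIntegral.tower_top
  obtain ⟨b, rfl⟩ := IsIntegrallyClosed.isIntegral_iff.1 h1
  have h2 : IsIntegral k b :=
    (isIntegral_algebraMap_iff (IsFractionRing.injective B (FractionRing B))).1 ht.isIntegral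
  by_cases h0 : b = 0
  · exact ⟨0, by simp [h0]⟩
  · obtain ⟨c, hc⟩ := hunits (h2.isUnit h0).unit
    refine ⟨c, ?_⟩
    rw [IsScalarTower.algebraMap_apply k B, ← hc]
    rfl

theorem Derivation.div_eq_zero {K : Type*} [Field K] [Algebra k K] (E : Derivation k K K) {a b : K}
    (hb : b ≠ 0) (h : b * E a = a * E b) : E (a / b) = 0 := by
  have h1 : E (a / b * b) = E a := by rw [div_mul_cancel₀ a hb]
  rw [E.leibniz, smul_eq_mul, smul_eq_mul] at h1
  have h2 : b * (b * E (a / b)) = 0 := by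
    have : b * (a / b) = a := mul_div_cancel₀ a hb
    linear_combination b * h1 + (- E b) * this + h
  exact (mul_eq_zero.1 ((mul_eq_zero.1 h2).resolve_left hb)).resolve_left hb

variable [CharZero k]

theorem exists_smul_eq_of_isWeight [IsIntegrallyClosed B] (htr : Algebra.trdeg k B ≤ 2)
    (hunits : ∀ b : Bˣ, ∃ c : kˣ, (b : B) = algebraMap k B (c : k))
    {D U : Derivation k B B} (hDU : IsFundamentalPair D U) {n : ℕ} (hn : 0 < n) {h : B}
    (hDh : D h = 0) (hh : IsWeight D U n h) (h0 : h ≠ 0) {d : ℤ} {a b : B}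
    (hDa : D a = 0) (ha : IsWeight D U d a) (hDb : D b = 0) (hb : IsWeight D U d b) (hb0 : b ≠ 0) :
    ∃ c : k, a = c • b := by
  have : CharZero B := charZero_of_injective_algebraMap (algebraMap k B).injective
  have hinj := IsFractionRing.injective B (FractionRing B)
  obtain ⟨D', hD'⟩ := D.exists_extend_fractionRing
  obtain ⟨E', hE'⟩ := (⁅D, U⁆ : Derivation k B B).exists_extend_fractionRing
  have hb0' : algebraMap B (FractionRing B) b ≠ 0 := fun h => hb0 (hinj (by rw [h, map_zero]))
  have hn' : (n : B) * h ≠ 0 := mul_ne_zero (Nat.cast_ne_zero.2 hn.ne') h0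
  have hDUh : D (U h) = n * h := by
    have := D_iterate_U hDU hDh hh 0
    simpa using this
  have halg : IsAlgebraic k (algebraMap B (FractionRing B) a / algebraMap B (FractionRing B) b) := by
    refine isAlgebraic_of_derivations (by rwa [trdeg_fractionRing]) D' E'
      (h := algebraMap B _ h) (p := algebraMap B _ (U h)) ?_ ?_ ?_ ?_ ?_
    · refine D'.div_eq_zero hb0' ?_
      rw [hD', hD', hDa, hDb]
      simp
    · refine E'.div_eq_zero hb0' ?_
      rw [hE', hE', ha, hb, ← map_mul, ← map_mul]
      congr 1
      ring
    · rw [hD', hDh, map_zero]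
    · rw [hE', hh]
      intro h1
      exact hn' (hinj (by simpa using h1))
    · rw [hD', hDUh]
      intro h1
      exact hn' (hinj (by rw [h1, map_zero]))
  obtain ⟨c, hc⟩ := exists_algebraMap_eq_of_isAlgebraic hunits halg
  refine ⟨c, hinj ?_⟩
  rw [div_eq_iff hb0', IsScalarTower.algebraMap_apply k B, ← map_mul] at hc
  rw [hc, Algebra.smul_def]

theorem algebraicIndependent_of_isWeight {D U : Derivation k B B} {n : ℕ}
    (hn : 0 < n) {h p : B} (hDh : D h = 0) (hh : IsWeight D U n h) (h0 : h ≠ 0) (hDp : D p = h) :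
    AlgebraicIndependent k ![h, p] := by
  have : CharZero B := charZero_of_injective_algebraMap (algebraMap k B).injective
  have hinj := IsFractionRing.injective B (FractionRing B)
  obtain ⟨D', hD'⟩ := D.exists_extend_fractionRing
  obtain ⟨E', hE'⟩ := (⁅D, U⁆ : Derivation k B B).exists_extend_fractionRing
  have hn' : (n : B) * h ≠ 0 := mul_ne_zero (Nat.cast_ne_zero.2 hn.ne') h0
  have ht : Transcendental k (algebraMap B (FractionRing B) h) := by
    intro ha
    have h1 := E'.eq_zero_of_isAlgebraic ⊥ (fun x hx => by
      obtain ⟨c, rfl⟩ := Algebra.mem_bot.1 hx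
      exact E'.map_algebraMap c) (y := algebraMap B (FractionRing B) h) (ha.extendScalars (algebraMap k (⊥ : Subalgebra k (FractionRing B))).injective)
    rw [hE', hh] at h1
    exact hn' (hinj (by simpa using h1))
  have h1 : AlgebraicIndependent k (fun _ : Unit => algebraMap B (FractionRing B) h) :=
    (algebraicIndependent_singleton_iff ()).2 ht
  have h2 := (h1.option_iff_transcendental (algebraMap B (FractionRing B) p)).2 (fun ha => by
    have := D'.eq_zero_of_isAlgebraic _ (fun x hx => D'.eq_zero_of_mem_adjoin (by
      rintro _ ⟨_, rfl⟩
      rw [hD', hDh, map_zero]) hx) ha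
    rw [hD', hDp] at this
    exact h0 (hinj (by rw [this, map_zero])))
  have h3 : AlgebraicIndependent k (IsScalarTower.toAlgHom k B (FractionRing B) ∘ ![h, p]) := by
    have h4 := h2.comp ![some (), none] (by
      intro i j
      fin_cases i <;> fin_cases j <;> simp)
    convert h4 using 1
    ext i
    fin_cases i <;> rfl
  exact h3.of_comp (IsScalarTower.toAlgHom k B (FractionRing B))

theorem exists_highest_weight_generator [IsIntegrallyClosed B] (htr : Algebra.trdeg k B ≤ 2)
    (hunits : ∀ b : Bˣ, ∃ c : kˣ, (b : B) = algebraMap k B (c : k))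
    {D U : Derivation k B B} (hDU : IsFundamentalPair D U) (hnt : ¬(D = 0 ∧ U = 0)) :
    ∃ (n : ℕ) (h : B), 0 < n ∧ h ≠ 0 ∧ D h = 0 ∧ IsWeight D U n h ∧
      ∀ (a : B) (d : ℤ), D a = 0 → IsWeight D U d a → a ≠ 0 →
        ∃ (q : ℕ) (c : k), d = q * n ∧ a = c • h ^ q := by
  classical
  have hex : ∃ n : ℕ, 0 < n ∧ ∃ h : B, h ≠ 0 ∧ D h = 0 ∧ IsWeight D U n h := by
    by_contra hcon
    push Not at hcon
    have hzero : ∀ (a : B) (d : ℤ), D a = 0 → IsWeight D U d a → U a = 0 := by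
      intro a d hDa ha
      by_cases h0 : a = 0
      · rw [h0, map_zero]
      obtain ⟨N, rfl, hN, -⟩ := highest_weight_nonneg hDU hDa ha h0
      rcases Nat.eq_zero_or_pos N with rfl | hpos
      · exact hN
      · exact absurd ha (hcon N hpos a h0 hDa)
    have htop := eq_top_of_iterate_U_mem hDU
      (LinearMap.ker D.toLinearMap ⊓ LinearMap.ker U.toLinearMap) (by
        intro a d j hDa ha
        cases j with
        | zero => exact ⟨hDa, hzero a d hDa ha⟩
        | succ j =>
          rw [Function.iterate_succ_apply, hzero a d hDa ha, iterate_map_zero]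
          exact zero_mem _)
    refine hnt ⟨?_, ?_⟩
    · ext b
      exact (htop.ge (Submodule.mem_top (x := b))).1
    · ext b
      exact (htop.ge (Submodule.mem_top (x := b))).2
  obtain ⟨hn, h, h0, hDh, hh⟩ := Nat.find_spec hex
  set n := Nat.find hex with hndef
  have hmin : ∀ m, 0 < m → m < n → ∀ a : B, a ≠ 0 → D a = 0 → ¬ IsWeight D U m a := by
    intro m hm hmn a h1 h2 h3
    exact Nat.find_min hex hmn ⟨hm, a, h1, h2, h3⟩
  refine ⟨n, h, hn, h0, hDh, hh, ?_⟩
  intro a d hDa ha ha0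
  obtain ⟨d, rfl, -, -⟩ := highest_weight_nonneg hDU hDa ha ha0
  have hDpow : ∀ m : ℕ, D (h ^ m) = 0 := fun m => by rw [D.leibniz_pow, hDh]; simp
  have hDapow : ∀ m : ℕ, D (a ^ m) = 0 := fun m => by rw [D.leibniz_pow, hDa]; simp
  have hdvd : n ∣ d := by
    by_contra hnd
    have hinj := IsFractionRing.injective B (FractionRing B)
    obtain ⟨c, hc⟩ := exists_smul_eq_of_isWeight htr hunits hDU hn hDh hh h0 (hDapow n)
      (ha.pow n) (hDpow d) (by convert hh.pow d using 1; ring) (pow_ne_zero d h0)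
    have h0' : algebraMap B (FractionRing B) h ≠ 0 := fun h1 => h0 (hinj (by rw [h1, map_zero]))
    have hint : IsIntegral B
        (algebraMap B (FractionRing B) a / algebraMap B (FractionRing B) h ^ (d / n)) := by
      refine IsIntegral.of_pow hn ?_
      have : (algebraMap B (FractionRing B) a / algebraMap B (FractionRing B) h ^ (d / n)) ^ n =
          algebraMap B (FractionRing B) (c • h ^ (d % n)) := by
        rw [div_pow, div_eq_iff (pow_ne_zero _ (pow_ne_zero _ h0')), ← map_pow, ← map_pow,
          ← map_pow, ← map_mul, hc, ← pow_mul, smul_mul_assoc, ← pow_add, mul_comm (d / n),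
          Nat.mod_add_div]
      rw [this]
      exact isIntegral_algebraMap
    obtain ⟨b, hb⟩ := IsIntegrallyClosed.isIntegral_iff.1 hint
    rw [eq_div_iff (pow_ne_zero _ h0'), ← map_pow, ← map_mul] at hb
    have hab : b * h ^ (d / n) = a := hinj hb
    have hpow0 : h ^ (d / n) ≠ 0 := pow_ne_zero _ h0
    have hb0 : b ≠ 0 := by
      rintro rfl
      exact ha0 (by rw [← hab, zero_mul])
    refine hmin (d % n) (Nat.pos_of_ne_zero fun h1 => hnd (Nat.dvd_of_mod_eq_zero h1))
      (Nat.mod_lt _ hn) b hb0 ?_ ?_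
    · have h1 := hDa
      rw [← hab, D.leibniz, hDpow, smul_zero, zero_add, smul_eq_mul] at h1
      exact (mul_eq_zero.1 h1).resolve_left hpow0
    · have h1 : IsWeight D U d a := ha
      have h2 := hh.pow (d / n)
      unfold IsWeight at h1 h2 ⊢
      rw [← hab, Derivation.leibniz, h2, smul_eq_mul, smul_eq_mul] at h1
      have h3 : (((d % n : ℕ) : ℤ) : B) = (d : ℤ) - ((d / n : ℕ) * n : ℤ) := by
        have := Nat.mod_add_div d n
        have h4 : ((d % n : ℕ) : ℤ) = (d : ℤ) - ((d / n : ℕ) * n : ℤ) := by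
          rw [mul_comm] at this
          zify at this ⊢
          linarith
        rw [h4]
        push_cast
        ring
      refine mul_left_cancel₀ hpow0 ?_
      rw [h3]
      push_cast at h1 ⊢
      linear_combination h1
  obtain ⟨q, rfl⟩ := hdvd
  obtain ⟨c, hc⟩ := exists_smul_eq_of_isWeight htr hunits hDU hn hDh hh h0 hDa ha (hDpow q)
    (by convert hh.pow q using 1; push_cast; ring) (pow_ne_zero q h0)
  exact ⟨q, c, by push_cast; ring, hc⟩

/-- The structure constants of a ring with a nontrivial fundamental pair. -/
theorem exists_structure [IsIntegrallyClosed B] (htr : Algebra.trdeg k B ≤ 2)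
    (hunits : ∀ b : Bˣ, ∃ c : kˣ, (b : B) = algebraMap k B (c : k))
    {D U : Derivation k B B} (hDU : IsFundamentalPair D U) (hnt : ¬(D = 0 ∧ U = 0)) :
    ∃ (n : ℕ) (h p : B), 0 < n ∧ h ≠ 0 ∧ AlgebraicIndependent k ![h, p] ∧ U h = n * p ∧
      U^[n + 1] h = 0 ∧
      (∀ S : Subalgebra k B, h ∈ S → (∀ x ∈ S, U x ∈ S) → S = ⊤) ∧
      (h * U p = (n - 1) * p ^ 2 ∨
        (∃ c : k, c ≠ 0 ∧ n = 2 ∧ h * U p = p ^ 2 + algebraMap k B c) ∨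
        (∃ c : k, c ≠ 0 ∧ n = 4 ∧ h * U p = 3 * p ^ 2 + algebraMap k B c * h)) := by
  have : CharZero B := charZero_of_injective_algebraMap (algebraMap k B).injective
  obtain ⟨n, h, hn, h0, hDh, hh, hgen⟩ := exists_highest_weight_generator htr hunits hDU hnt
  have hnk : (n : k) ≠ 0 := Nat.cast_ne_zero.2 hn.ne'
  have hDUh : D (U h) = n * h := by
    have := D_iterate_U hDU hDh hh 0
    simpa using this
  have hnn : algebraMap k B (n : k)⁻¹ * (n : B) = 1 := by
    rw [← map_natCast (algebraMap k B), ← map_mul, inv_mul_cancel₀ hnk, map_one]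
  obtain ⟨p, hp⟩ : ∃ p, p = (n : k)⁻¹ • U h := ⟨_, rfl⟩
  have hUh : U h = n * p := by
    rw [hp, Algebra.smul_def]
    linear_combination -(U h) * hnn
  have hDp : D p = h := by
    rw [hp, D.map_smul, hDUh, Algebra.smul_def, ← mul_assoc, hnn, one_mul]
  have hwp : IsWeight D U (n - 2) p := by
    rw [hp]
    exact (hh.map_U hDU).smul _
  have hN : U^[n + 1] h = 0 := by
    obtain ⟨N, hN, hN', -⟩ := highest_weight_nonneg hDU hDh hh h0
    rw [Nat.cast_inj.1 hN]
    exact hN'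
  refine ⟨n, h, p, hn, h0, algebraicIndependent_of_isWeight hn hDh hh h0 hDp, hUh, hN, ?_, ?_⟩
  · intro S hS hUS
    have := eq_top_of_iterate_U_mem hDU (Subalgebra.toSubmodule S) (by
      intro a d j hDa ha
      have hmem : a ∈ S := by
        by_cases ha0 : a = 0
        · rw [ha0]
          exact zero_mem S
        obtain ⟨q, c, -, rfl⟩ := hgen a d hDa ha ha0
        exact S.smul_mem (pow_mem hS q) c
      change U^[j] a ∈ S
      induction j with
      | zero => exact hmem
      | succ j ih =>
        rw [Function.iterate_succ_apply']
        exact hUS _ ih)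
    exact Algebra.toSubmodule_eq_top.1 this
  · have hDUp : D (U p) = (2 * n - 2) * p := by
      have h1 : ⁅D, U⁆ p = D (U p) - U (D p) := Derivation.commutator_apply ..
      rw [hwp, hDp, hUh] at h1
      push_cast at h1
      linear_combination -h1
    have hDW : D (h * U p - ((n - 1 : ℤ) : B) * p ^ 2) = 0 := by
      rw [map_sub, D.leibniz, D.leibniz, D.leibniz_pow, D.map_intCast, hDUp, hDh, hDp]
      simp
      ring
    have hwW : IsWeight D U (2 * n - 4) (h * U p - ((n - 1 : ℤ) : B) * p ^ 2) := by
      refine IsWeight.sub ?_ ?_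
      · convert hh.mul (hwp.map_U hDU) using 1
        ring
      · have h1 : IsWeight D U 0 ((n - 1 : ℤ) : B) := by
          unfold IsWeight
          rw [Derivation.map_intCast]
          simp
        convert h1.mul (hwp.pow 2) using 1
        push_cast
        ring
    by_cases hW0 : h * U p - ((n - 1 : ℤ) : B) * p ^ 2 = 0
    · left
      push_cast at hW0
      linear_combination hW0
    · right
      obtain ⟨q, c, hq, hc⟩ := hgen _ _ hDW hwW hW0
      have hc0 : c ≠ 0 := by
        rintro rfl
        exact hW0 (by rw [hc, zero_smul])
      have hq2 : q < 2 := by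
        by_contra hcon
        have : (2 : ℤ) * n ≤ q * n := by
          have : 2 ≤ q := by omega
          gcongr
          exact_mod_cast this
        omega
      rw [Algebra.smul_def] at hc
      interval_cases q
      · left
        have hn2 : n = 2 := by
          push_cast at hq
          omega
        refine ⟨c, hc0, hn2, ?_⟩
        rw [hn2] at hc
        push_cast at hc
        linear_combination hc
      · right
        have hn4 : n = 4 := by
          push_cast at hq
          omega
        refine ⟨c, hc0, hn4, ?_⟩
        rw [hn4] at hc
        push_cast at hc
        linear_combination hc

end HighestWeight

section NotUFD

theorem not_isUFDRing_of_irreducible {R : Type*} [CommRing R] {p a b : R} (hp : Irreducible p)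
    (hab : p ∣ a * b) (ha : ¬ p ∣ a) (hb : ¬ p ∣ b) : ¬ IsUFDRing R := by
  rintro ⟨_, _⟩
  exact ((UniqueFactorizationMonoid.irreducible_iff_prime.1 hp).dvd_or_dvd hab).elim ha hb

end NotUFD

namespace Slam

variable {k : Type*} [Field k] {lam : k}

/-- The image of the variable `xᵢ` in `S_λ(k)`. -/
noncomputable def x (lam : k) (i : Fin 3) : Slam k lam := Ideal.Quotient.mk (SIdeal k lam) (X i)

theorem relation : 2 * x lam 0 * x lam 2 = x lam 1 ^ 2 + algebraMap k (Slam k lam) lam := by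
  have h : Ideal.Quotient.mk (SIdeal k lam) (2 * X 0 * X 2 - X 1 ^ 2 - C lam) = 0 :=
    Ideal.Quotient.eq_zero_iff_mem.2 (Ideal.subset_span rfl)
  have h' : Ideal.Quotient.mk (SIdeal k lam) (C lam) = algebraMap k (Slam k lam) lam := rfl
  simp only [map_sub, map_mul, map_pow, map_ofNat, h'] at h
  unfold x
  linear_combination h

theorem induction {P : Slam k lam → Prop} (f : Slam k lam)
    (hC : ∀ c, P (algebraMap k _ c)) (hadd : ∀ f g, P f → P g → P (f + g))
    (hX : ∀ f i, P f → P (f * x lam i)) : P f := by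
  obtain ⟨f, rfl⟩ := Ideal.Quotient.mk_surjective f
  induction f using MvPolynomial.induction_on with
  | C c => exact hC c
  | add f g hf hg => rw [map_add]; exact hadd _ _ hf hg
  | mul_X f i hf => rw [map_mul]; exact hX _ _ hf

section Lift

variable {A : Type*} [CommRing A] [Algebra k A]

/-- The homomorphism from `S_λ(k)` determined by a solution of its defining equation. -/
noncomputable def lift (a : Fin 3 → A) (h : 2 * a 0 * a 2 = a 1 ^ 2 + algebraMap k A lam) :
    Slam k lam →ₐ[k] A :=
  Ideal.Quotient.liftₐ (SIdeal k lam) (aeval a) (by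
    have : SIdeal k lam ≤ RingHom.ker (aeval a : MvPolynomial (Fin 3) k →ₐ[k] A) := by
      rw [Ideal.span_le, Set.singleton_subset_iff, SetLike.mem_coe, RingHom.mem_ker]
      simp only [map_sub, map_mul, map_pow, map_ofNat, aeval_X, aeval_C]
      linear_combination h
    exact fun f hf => this hf)

@[simp]
theorem lift_x (a : Fin 3 → A) (h : 2 * a 0 * a 2 = a 1 ^ 2 + algebraMap k A lam) (i : Fin 3) :
    lift a h (x lam i) = a i :=
  aeval_X a i

theorem range_lift (a : Fin 3 → A) (h : 2 * a 0 * a 2 = a 1 ^ 2 + algebraMap k A lam) :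
    (lift a h).range = Algebra.adjoin k (Set.range a) := by
  refine le_antisymm ?_ (Algebra.adjoin_le ?_)
  · rintro _ ⟨f, rfl⟩
    change lift a h f ∈ _
    induction f using induction with
    | hC c => rw [AlgHom.commutes]; exact algebraMap_mem _ c
    | hadd f g hf hg => rw [map_add]; exact add_mem hf hg
    | hX f i hf =>
      rw [map_mul, lift_x]
      exact mul_mem hf (Algebra.subset_adjoin ⟨i, rfl⟩)
  · rintro _ ⟨i, rfl⟩
    exact ⟨x lam i, lift_x a h i⟩

end Lift

/-- The inclusion of the polynomial ring in `x₀, x₁`. -/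
noncomputable def ofPoly (lam : k) : MvPolynomial (Fin 2) k →ₐ[k] Slam k lam :=
  aeval ![x lam 0, x lam 1]

@[simp]
theorem ofPoly_X_zero : ofPoly lam (X 0) = x lam 0 := by
  simp [ofPoly]

@[simp]
theorem ofPoly_X_one : ofPoly lam (X 1) = x lam 1 := by
  simp [ofPoly]

theorem exists_pow_mul_eq_ofPoly [CharZero k] (f : Slam k lam) :
    ∃ N g, x lam 0 ^ N * f = ofPoly lam g := by
  induction f using induction with
  | hC c => exact ⟨0, C c, by simp [← algebraMap_eq]⟩
  | hadd f₁ f₂ h₁ h₂ =>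
    obtain ⟨N₁, g₁, h₁⟩ := h₁
    obtain ⟨N₂, g₂, h₂⟩ := h₂
    refine ⟨N₁ + N₂, X 0 ^ N₂ * g₁ + X 0 ^ N₁ * g₂, ?_⟩
    simp only [map_add, map_mul, map_pow, ofPoly_X_zero, ← h₁, ← h₂]
    ring
  | hX f i h =>
    obtain ⟨N, g, h⟩ := h
    fin_cases i
    · refine ⟨N, g * X 0, ?_⟩
      simp only [map_mul, ofPoly_X_zero, ← h]
      exact (mul_assoc _ _ _).symm
    · refine ⟨N, g * X 1, ?_⟩
      simp only [map_mul, ofPoly_X_one, ← h]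
      exact (mul_assoc _ _ _).symm
    · refine ⟨N + 1, C 2⁻¹ * (g * (X 1 ^ 2 + C lam)), ?_⟩
      have h2 : ofPoly lam (C 2⁻¹) * 2 = 1 := by
        rw [← algebraMap_eq, AlgHom.commutes, ← map_ofNat (algebraMap k (Slam k lam)), ← map_mul,
          inv_mul_cancel₀ two_ne_zero, map_one]
      have hl : ofPoly lam (C lam) = algebraMap k (Slam k lam) lam := by
        rw [← algebraMap_eq, AlgHom.commutes]
      simp only [map_mul, map_add, map_pow, ofPoly_X_one, ← h, hl, ← relation]
      change _ * (f * x lam 2) = _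
      linear_combination (- x lam 0 ^ (N + 1) * f * x lam 2) * h2

theorem eq_zero_of_x_zero_mul (hlam : lam ≠ 0) {f : Slam k lam} (hf : x lam 0 * f = 0) :
    f = 0 := by
  obtain ⟨f, rfl⟩ := Ideal.Quotient.mk_surjective f
  rw [x, ← map_mul, Ideal.Quotient.eq_zero_iff_mem, Ideal.mem_span_singleton] at hf
  obtain ⟨g, hg⟩ := hf
  have hdvd : (X 0 : MvPolynomial (Fin 3) k) ∣ (2 * X 0 * X 2 - X 1 ^ 2 - C lam) * g :=
    ⟨f, hg.symm⟩
  rcases (X_prime (R := k) (i := (0 : Fin 3))).dvd_or_dvd hdvd with ⟨u, hu⟩ | ⟨u, rfl⟩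
  · have := congrArg (eval (0 : Fin 3 → k)) hu
    simp at this
    exact absurd this hlam
  · rw [Ideal.Quotient.eq_zero_iff_mem, Ideal.mem_span_singleton]
    refine ⟨u, mul_left_cancel₀ (X_ne_zero (0 : Fin 3)) ?_⟩
    rw [hg]
    ring

theorem eq_zero_of_x_zero_pow_mul (hlam : lam ≠ 0) {f : Slam k lam} (N : ℕ)
    (hf : x lam 0 ^ N * f = 0) : f = 0 := by
  induction N with
  | zero => simpa using hf
  | succ N ih =>
    rw [pow_succ', mul_assoc] at hf
    exact ih (eq_zero_of_x_zero_mul hlam hf)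

theorem lift_injective [CharZero k] {A : Type*} [CommRing A] [Algebra k A] (hlam : lam ≠ 0)
    (a : Fin 3 → A) (h : 2 * a 0 * a 2 = a 1 ^ 2 + algebraMap k A lam)
    (ha : AlgebraicIndependent k ![a 0, a 1]) : Function.Injective (lift a h) := by
  rw [injective_iff_map_eq_zero]
  intro f hf
  obtain ⟨N, g, hg⟩ := exists_pow_mul_eq_ofPoly f
  have hcomp : ((lift a h).comp (ofPoly lam)) = aeval ![a 0, a 1] := by
    ext i
    fin_cases i <;> simp
  have h1 : aeval ![a 0, a 1] g = 0 := by
    rw [← hcomp, AlgHom.comp_apply, ← hg, map_mul, hf, mul_zero]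
  rw [(injective_iff_map_eq_zero _).1 ha g h1, map_zero] at hg
  exact eq_zero_of_x_zero_pow_mul hlam N hg

theorem exists_embedding [CharZero k] (hlam : lam ≠ 0) :
    ∃ φ : Slam k lam →ₐ[k] FractionRing (MvPolynomial (Fin 2) k), Function.Injective φ ∧
      ∀ g, φ (ofPoly lam g) = algebraMap _ _ g := by
  let R := MvPolynomial (Fin 2) k
  have hinj := IsFractionRing.injective R (FractionRing R)
  have h0 : algebraMap R (FractionRing R) (X 0) ≠ 0 := fun h =>
    X_ne_zero (0 : Fin 2) (hinj (by rw [h, map_zero]))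
  have : CharZero (FractionRing R) := charZero_of_injective_algebraMap
    (algebraMap k (FractionRing R)).injective
  let a : Fin 3 → FractionRing R := ![algebraMap R _ (X 0), algebraMap R _ (X 1),
    (algebraMap R _ (X 1) ^ 2 + algebraMap k _ lam) / (2 * algebraMap R _ (X 0))]
  have ha : 2 * a 0 * a 2 = a 1 ^ 2 + algebraMap k _ lam := by
    simp only [a, Matrix.cons_val]
    rw [mul_div_cancel₀]
    exact mul_ne_zero two_ne_zero h0
  have hcomp : ((lift a ha).comp (ofPoly lam)) = IsScalarTower.toAlgHom k R (FractionRing R) := by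
    ext i
    fin_cases i <;> simp [a, R]
  refine ⟨lift a ha, lift_injective hlam a ha ?_, fun g => DFunLike.congr_fun hcomp g⟩
  have h1 : (aeval ![a 0, a 1] : R →ₐ[k] FractionRing R) =
      IsScalarTower.toAlgHom k R (FractionRing R) := by
    ext i
    fin_cases i <;> simp [a, R]
  rw [AlgebraicIndependent, h1]
  exact hinj

theorem ofPoly_injective [CharZero k] (hlam : lam ≠ 0) : Function.Injective (ofPoly lam) := by
  obtain ⟨φ, -, h⟩ := exists_embedding hlam
  refine Function.Injective.of_comp (f := φ) ?_
  have : φ ∘ ofPoly lam = algebraMap _ _ := funext h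
  rw [this]
  exact IsFractionRing.injective _ _

theorem isDomain [CharZero k] (hlam : lam ≠ 0) : IsDomain (Slam k lam) := by
  obtain ⟨φ, hφ, -⟩ := exists_embedding hlam
  exact hφ.isDomain φ.toRingHom

theorem x_zero_ne_zero [CharZero k] (hlam : lam ≠ 0) : x lam 0 ≠ 0 := by
  rw [← ofPoly_X_zero, Ne, map_eq_zero_iff _ (ofPoly_injective hlam)]
  exact X_ne_zero _

/-- Evaluation on the fibre `x₀ = 0`. -/
noncomputable def fibre {F : Type*} [Field F] [Algebra k F] {c : F}
    (hc : c ^ 2 = algebraMap k F (-lam)) : Slam k lam →ₐ[k] Polynomial F :=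
  lift ![0, Polynomial.C c, Polynomial.X] (by
    have : algebraMap k (Polynomial F) lam = Polynomial.C (algebraMap k F lam) := rfl
    simp [← Polynomial.C_pow, hc, this])

section Fibre

variable {F : Type*} [Field F] [Algebra k F] {c : F} (hc : c ^ 2 = algebraMap k F (-lam))

@[simp] theorem fibre_x_zero : fibre hc (x lam 0) = 0 := lift_x _ _ _

@[simp] theorem fibre_x_one : fibre hc (x lam 1) = Polynomial.C c := lift_x _ _ _

@[simp] theorem fibre_x_two : fibre hc (x lam 2) = Polynomial.X := lift_x _ _ _

end Fibre

theorem exists_sq_algebraicClosure (lam : k) :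
    ∃ c : AlgebraicClosure k, c ^ 2 = algebraMap k (AlgebraicClosure k) (-lam) :=
  IsAlgClosed.exists_pow_nat_eq _ two_pos

theorem not_isUnit_x_zero : ¬ IsUnit (x lam 0) := by
  obtain ⟨c, hc⟩ := exists_sq_algebraicClosure lam
  intro h
  have := h.map (fibre hc)
  simp at this

theorem exists_eq_add_x_zero_mul (f : Slam k lam) :
    ∃ (p q : Polynomial k) (g : Slam k lam), f =
      Polynomial.aeval (x lam 2) p + Polynomial.aeval (x lam 2) q * x lam 1 + x lam 0 * g := by
  induction f using induction with
  | hC c => exact ⟨Polynomial.C c, 0, 0, by simp⟩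
  | hadd f₁ f₂ h₁ h₂ =>
    obtain ⟨p₁, q₁, g₁, h₁⟩ := h₁
    obtain ⟨p₂, q₂, g₂, h₂⟩ := h₂
    refine ⟨p₁ + p₂, q₁ + q₂, g₁ + g₂, ?_⟩
    rw [h₁, h₂, map_add, map_add]
    ring
  | hX f i h =>
    obtain ⟨p, q, g, h⟩ := h
    fin_cases i
    · refine ⟨0, 0, f, ?_⟩
      simp [mul_comm]
    · refine ⟨-Polynomial.C lam * q, p, g * x lam 1 + 2 * Polynomial.aeval (x lam 2) q * x lam 2, ?_⟩
      change f * x lam 1 = _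
      simp only [map_mul, map_neg, Polynomial.aeval_C]
      rw [h]
      linear_combination - Polynomial.aeval (x lam 2) q * relation (lam := lam)
    · refine ⟨p * Polynomial.X, q * Polynomial.X, g * x lam 2, ?_⟩
      change f * x lam 2 = _
      simp only [map_mul, Polynomial.aeval_X]
      rw [h]
      ring

theorem x_zero_dvd_of_fibre_eq_zero (hsq : ¬ ∃ c : k, c ^ 2 = -lam) {F : Type*} [Field F]
    [Algebra k F] {c : F} (hc : c ^ 2 = algebraMap k F (-lam)) {f : Slam k lam}
    (hf : fibre hc f = 0) : x lam 0 ∣ f := by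
  obtain ⟨p, q, g, rfl⟩ := exists_eq_add_x_zero_mul f
  have hmap : ∀ r : Polynomial k, Polynomial.aeval (Polynomial.X : Polynomial F) r =
      r.map (algebraMap k F) := fun r => by
    rw [Polynomial.aeval_X_left_eq_map]
  have hcoeff : ∀ i, algebraMap k F (p.coeff i) + algebraMap k F (q.coeff i) * c = 0 := by
    intro i
    have := congrArg (fun r => Polynomial.coeff r i) hf
    simpa [← Polynomial.aeval_algHom_apply, hmap] using this
  have hq : q = 0 := by
    ext i
    by_contra hqi
    rw [Polynomial.coeff_zero] at hqi
    have hqi' : algebraMap k F (q.coeff i) ≠ 0 := (map_ne_zero _).2 hqi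
    refine hsq ⟨-p.coeff i / q.coeff i, (algebraMap k F).injective ?_⟩
    rw [← hc, map_pow, map_div₀, map_neg]
    congr 1
    rw [div_eq_iff hqi']
    linear_combination -hcoeff i
  have hp : p = 0 := by
    ext i
    have := hcoeff i
    simpa [hq] using this
  simp [hp, hq]

theorem prime_x_zero [CharZero k] (hlam : lam ≠ 0) (hsq : ¬ ∃ c : k, c ^ 2 = -lam) :
    Prime (x lam 0) := by
  obtain ⟨c, hc⟩ := exists_sq_algebraicClosure lam
  refine ⟨x_zero_ne_zero hlam, not_isUnit_x_zero, fun a b ⟨g, hab⟩ => ?_⟩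
  have := congrArg (fibre hc) hab
  rw [map_mul, map_mul, fibre_x_zero, zero_mul, mul_eq_zero] at this
  exact this.imp (x_zero_dvd_of_fibre_eq_zero hsq hc) (x_zero_dvd_of_fibre_eq_zero hsq hc)

theorem exists_eq_smul_pow_of_mul_eq [CharZero k] (hlam : lam ≠ 0) {a b : Slam k lam} {n : ℕ}
    (hab : a * b = x lam 0 ^ n) : ∃ (c : k) (i : ℕ), c ≠ 0 ∧ a = algebraMap k _ c * x lam 0 ^ i := by
  have := isDomain hlam
  obtain ⟨N, g, hg⟩ := exists_pow_mul_eq_ofPoly a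
  obtain ⟨M, g', hg'⟩ := exists_pow_mul_eq_ofPoly b
  have hgg : g * g' = X 0 ^ (N + M + n) := by
    apply ofPoly_injective hlam
    rw [map_mul, ← hg, ← hg', map_pow, ofPoly_X_zero, pow_add, ← hab]
    ring
  obtain ⟨i, -, hi⟩ := (dvd_prime_pow (X_prime (R := k) (i := (0 : Fin 2))) _).1 ⟨g', hgg.symm⟩
  obtain ⟨u, hu⟩ := hi.symm
  obtain ⟨c, hc, huc⟩ := isUnit_iff_eq_C_of_isReduced.1 u.isUnit
  have hc0 : c ≠ 0 := hc.ne_zero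
  rw [← hu, huc, map_mul, map_pow, ofPoly_X_zero, ← algebraMap_eq, AlgHom.commutes] at hg
  rcases le_or_gt N i with h | h
  · refine ⟨c, i - N, hc0, mul_left_cancel₀ (pow_ne_zero N (x_zero_ne_zero hlam)) ?_⟩
    rw [hg, mul_left_comm, ← pow_add, Nat.add_sub_cancel' h, mul_comm]
  · exfalso
    have h1 : x lam 0 ^ (N - i) * a = algebraMap k _ c := by
      refine mul_left_cancel₀ (pow_ne_zero i (x_zero_ne_zero hlam)) ?_
      rw [← mul_assoc, ← pow_add, Nat.add_sub_cancel' h.le, hg]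
    have h2 : IsUnit (x lam 0 ^ (N - i) * a) := by
      rw [h1]
      exact hc.map _
    exact not_isUnit_x_zero
      ((isUnit_pow_iff (Nat.sub_ne_zero_of_lt h)).1 (isUnit_of_mul_isUnit_left h2))

theorem irreducible_x_zero [CharZero k] (hlam : lam ≠ 0) : Irreducible (x lam 0) := by
  have := isDomain hlam
  refine ⟨not_isUnit_x_zero, fun {a b} hab => ?_⟩
  obtain ⟨c, i, hc, ha⟩ := exists_eq_smul_pow_of_mul_eq hlam (n := 1) (by rw [pow_one, hab])
  obtain ⟨c', j, hc', hb⟩ := exists_eq_smul_pow_of_mul_eq hlam (n := 1) (a := b) (b := a)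
    (by rw [pow_one, hab, mul_comm])
  have hu : ∀ c : k, c ≠ 0 → IsUnit (algebraMap k (Slam k lam) c) := fun c hc =>
    (isUnit_iff_ne_zero.2 hc).map _
  rcases i with _ | i
  · left
    rw [ha, pow_zero, mul_one]
    exact hu c hc
  rcases j with _ | j
  · right
    rw [hb, pow_zero, mul_one]
    exact hu c' hc'
  exfalso
  refine not_isUnit_x_zero (lam := lam) (IsUnit.of_mul_eq_one
    (algebraMap k _ c * algebraMap k _ c' * x lam 0 ^ (i + j)) ?_)
  refine mul_left_cancel₀ (x_zero_ne_zero hlam) ?_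
  rw [mul_one]
  conv_rhs => rw [hab, ha, hb]
  ring

theorem not_isUFDRing_of_isSquare [CharZero k] (hlam : lam ≠ 0) {c : k} (hc : c ^ 2 = -lam) :
    ¬ IsUFDRing (Slam k lam) := by
  have hl : algebraMap k (Slam k lam) lam = - algebraMap k _ c ^ 2 := by
    rw [← map_pow, hc, map_neg, neg_neg]
  have hc0 : c ≠ 0 := by
    rintro rfl
    exact hlam (by simpa using hc.symm)
  have h2 : ∀ e : k, e ≠ 0 → e + e ≠ 0 := fun e he => by
    rw [← two_mul]
    exact mul_ne_zero two_ne_zero he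
  have key : ∀ e : k, e ^ 2 = -lam → ¬ x lam 0 ∣ x lam 1 + algebraMap k _ e := by
    rintro e he ⟨g, hg⟩
    have h1 := congrArg (fibre (F := k) (c := e) he) hg
    have h3 : algebraMap k (Polynomial k) e = Polynomial.C e := rfl
    have he0 : e ≠ 0 := by
      rintro rfl
      exact hlam (by simpa using he.symm)
    simp only [map_add, map_mul, AlgHom.commutes, fibre_x_zero, fibre_x_one, zero_mul, h3] at h1
    rw [← Polynomial.C_add, Polynomial.C_eq_zero] at h1
    exact h2 e he0 h1
  refine not_isUFDRing_of_irreducible (irreducible_x_zero hlam) ⟨2 * x lam 2, ?_⟩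
    (key c hc) (key (-c) (by rw [neg_sq, hc]))
  rw [map_neg]
  linear_combination -relation (lam := lam) - hl

theorem prime_of_prime_ofPoly [CharZero k] (hlam : lam ≠ 0) (hsq : ¬ ∃ c : k, c ^ 2 = -lam)
    {π : MvPolynomial (Fin 2) k} (hπ : Prime π) {e : ℕ} {b : Slam k lam}
    (hb : ofPoly lam π = x lam 0 ^ e * b) (hxb : ¬ x lam 0 ∣ b) (hπx : ¬ π ∣ X 0)
    (hbu : ¬ IsUnit b) : Prime b := by
  have := isDomain hlam
  refine ⟨fun h => hxb (h ▸ dvd_zero _), hbu, fun u v ⟨w, huv⟩ => ?_⟩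
  obtain ⟨N, g, hg⟩ := exists_pow_mul_eq_ofPoly u
  obtain ⟨M, g', hg'⟩ := exists_pow_mul_eq_ofPoly v
  obtain ⟨L, g'', hg''⟩ := exists_pow_mul_eq_ofPoly w
  have key : ∀ (N : ℕ) (g) (u : Slam k lam), x lam 0 ^ N * u = ofPoly lam g → π ∣ g → b ∣ u := by
    rintro N _ u hg ⟨t, rfl⟩
    have h1 : x lam 0 ^ N ∣ b * (x lam 0 ^ e * ofPoly lam t) := by
      refine ⟨u, ?_⟩
      rw [hg, map_mul, hb]
      ring
    obtain ⟨r, hr⟩ := (prime_x_zero hlam hsq).pow_dvd_of_dvd_mul_left N hxb h1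
    refine ⟨r, mul_left_cancel₀ (pow_ne_zero N (x_zero_ne_zero hlam)) ?_⟩
    rw [hg, map_mul, hb]
    linear_combination b * hr
  have h1 : X 0 ^ (L + e) * (g * g') = π * (X 0 ^ (N + M) * g'') := by
    apply ofPoly_injective hlam
    simp only [map_mul, map_pow, ofPoly_X_zero, ← hg, ← hg', ← hg'', hb]
    linear_combination x lam 0 ^ (L + e + N + M) * huv
  rcases hπ.dvd_or_dvd (Dvd.intro _ h1.symm) with h2 | h2
  · exact absurd (hπ.dvd_of_dvd_pow h2) hπx
  · exact (hπ.dvd_or_dvd h2).imp (key N g u hg) (key M g' v hg')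

theorem isUFDRing [CharZero k] (hlam : lam ≠ 0) (hsq : ¬ ∃ c : k, c ^ 2 = -lam) :
    IsUFDRing (Slam k lam) := by
  have hdom := isDomain hlam
  refine ⟨hdom, ?_⟩
  refine UniqueFactorizationMonoid.iff_exists_prime_mem_of_isPrime.2 fun P hP hPp => ?_
  by_cases hxP : x lam 0 ∈ P
  · exact ⟨_, hxP, prime_x_zero hlam hsq⟩
  have hQ : P.comap (ofPoly lam) ≠ ⊥ := by
    obtain ⟨f, hfP, hf0⟩ := Submodule.exists_mem_ne_zero_of_ne_bot hP
    obtain ⟨N, g, hg⟩ := exists_pow_mul_eq_ofPoly f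
    intro h
    have hgQ : g ∈ P.comap (ofPoly lam) := by
      rw [Ideal.mem_comap, ← hg]
      exact P.mul_mem_left _ hfP
    rw [h, Ideal.mem_bot] at hgQ
    rw [hgQ, map_zero] at hg
    exact hf0 (eq_zero_of_x_zero_pow_mul hlam N hg)
  obtain ⟨π, hπQ, hπ⟩ := UniqueFactorizationMonoid.iff_exists_prime_mem_of_isPrime.1
    inferInstance _ hQ (Ideal.comap_isPrime _ P)
  have hπ0 : ofPoly lam π ≠ 0 := by
    rw [Ne, map_eq_zero_iff _ (ofPoly_injective hlam)]
    exact hπ.ne_zero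
  obtain ⟨b, hb, hxb⟩ :=
    (FiniteMultiplicity.of_not_isUnit (not_isUnit_x_zero (lam := lam))
      hπ0).exists_eq_pow_mul_and_not_dvd
  have hbP : b ∈ P := by
    rw [Ideal.mem_comap, hb] at hπQ
    exact (hPp.mem_or_mem hπQ).resolve_left fun h => hxP (hPp.mem_of_pow_mem _ h)
  refine ⟨b, hbP, prime_of_prime_ofPoly hlam hsq hπ hb hxb ?_ fun h => ?_⟩
  · rintro ⟨t, ht⟩
    refine hxP ?_
    rw [← ofPoly_X_zero, ht, map_mul]
    exact P.mul_mem_right _ hπQ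
  · exact hPp.ne_top (P.eq_top_of_isUnit_mem hbP h)

theorem isUFDRing_iff [CharZero k] (hlam : lam ≠ 0) :
    IsUFDRing (Slam k lam) ↔ ¬ ∃ c : k, c ^ 2 = -lam :=
  ⟨fun h ⟨_, hc⟩ => not_isUFDRing_of_isSquare hlam hc h, isUFDRing hlam⟩

/-- The automorphism of `S_λ(k)` changing the sign of all variables. -/
noncomputable def neg (lam : k) : Slam k lam →ₐ[k] Slam k lam :=
  lift (fun i => -x lam i) (by
    have := relation (lam := lam)
    linear_combination this)

theorem neg_x (i : Fin 3) : neg lam (x lam i) = -x lam i :=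
  lift_x _ _ _

end Slam

namespace Qlam

variable {k : Type*} [Field k] {lam : k}

open Slam

theorem eq_adjoin (lam : k) : Qlam k lam = Algebra.adjoin k
    {x lam 2 ^ 2, x lam 1 * x lam 2, 3 * x lam 0 * x lam 2 - algebraMap k _ lam,
      x lam 0 * x lam 1, x lam 0 ^ 2} := by
  rw [Qlam]
  simp only [map_mul, map_pow, map_sub, map_ofNat]
  rfl

theorem neg_eq_self {f : Slam k lam} (hf : f ∈ Qlam k lam) : neg lam f = f := by
  have : Qlam k lam ≤ AlgHom.equalizer (neg lam) (AlgHom.id k _) := by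
    rw [eq_adjoin, Algebra.adjoin_le_iff]
    rintro _ (rfl | rfl | rfl | rfl | rfl) <;>
      simp [neg_x, map_ofNat (neg lam) 3] <;> ring
  exact this hf

theorem x_zero_notMem [CharZero k] (hlam : lam ≠ 0) : x lam 0 ∉ Qlam k lam := by
  intro h
  have h1 := neg_eq_self h
  rw [neg_x] at h1
  have := isDomain hlam
  have : CharZero (Slam k lam) :=
    charZero_of_injective_algebraMap (algebraMap k (Slam k lam)).injective
  exact x_zero_ne_zero hlam (self_eq_neg.1 h1.symm)

theorem irreducible_of_coe_eq [CharZero k] (hlam : lam ≠ 0) {q : Qlam k lam}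
    (hq : (q : Slam k lam) = x lam 0 ^ 2) : Irreducible q := by
  have := isDomain hlam
  refine ⟨fun h => ?_, fun {a b} hab => ?_⟩
  · have := h.map (Qlam k lam).val
    rw [Subalgebra.val_apply, hq, isUnit_pow_iff two_ne_zero] at this
    exact not_isUnit_x_zero this
  have hab' : (a : Slam k lam) * b = x lam 0 ^ 2 := by
    rw [← hq, hab]
    rfl
  have key : ∀ a : Qlam k lam, ∀ (c : k) (i : ℕ), c ≠ 0 →
      (a : Slam k lam) = algebraMap k _ c * x lam 0 ^ i → IsUnit a ∨ ∃ j, i = j + 2 := by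
    intro a c i hc ha
    rcases i with _ | _ | i
    · left
      have : a = algebraMap k _ c := Subtype.ext (by rw [ha, pow_zero, mul_one]; rfl)
      rw [this]
      exact (isUnit_iff_ne_zero.2 hc).map _
    · exfalso
      refine x_zero_notMem hlam ?_
      have h1 : x lam 0 = algebraMap k _ c⁻¹ * a := by
        rw [ha, ← mul_assoc, ← map_mul, inv_mul_cancel₀ hc]
        simp
      rw [h1]
      exact mul_mem (algebraMap_mem _ _) a.2
    · exact Or.inr ⟨i, rfl⟩
  obtain ⟨c, i, hc, ha⟩ := exists_eq_smul_pow_of_mul_eq hlam hab'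
  obtain ⟨c', j, hc', hb⟩ := exists_eq_smul_pow_of_mul_eq hlam ((mul_comm _ _).trans hab')
  rcases key a c i hc ha with h | ⟨i, rfl⟩
  · exact Or.inl h
  rcases key b c' j hc' hb with h | ⟨j, rfl⟩
  · exact Or.inr h
  exfalso
  refine not_isUnit_x_zero (lam := lam) (IsUnit.of_mul_eq_one
    (algebraMap k _ c * algebraMap k _ c' * x lam 0 ^ (i + j + 1)) ?_)
  refine mul_left_cancel₀ (pow_ne_zero 2 (x_zero_ne_zero hlam)) ?_
  rw [mul_one]
  conv_rhs => rw [← hab', ha, hb]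
  ring

theorem not_isUFDRing [CharZero k] (hlam : lam ≠ 0) : ¬ IsUFDRing (Qlam k lam) := by
  have := isDomain hlam
  have hmem : ∀ f ∈ ({x lam 2 ^ 2, x lam 1 * x lam 2,
      3 * x lam 0 * x lam 2 - algebraMap k _ lam, x lam 0 * x lam 1, x lam 0 ^ 2} :
      Set (Slam k lam)), f ∈ Qlam k lam := by
    rw [eq_adjoin]
    exact fun f hf => Algebra.subset_adjoin hf
  have h00 : x lam 0 ^ 2 ∈ Qlam k lam := hmem _ (by simp)
  have h01 : x lam 0 * x lam 1 ∈ Qlam k lam := hmem _ (by simp)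
  have h02 : 3 * x lam 0 * x lam 2 - algebraMap k _ lam ∈ Qlam k lam := hmem _ (by simp)
  have h11 : x lam 1 ^ 2 ∈ Qlam k lam := by
    have h3 : algebraMap k (Slam k lam) 3⁻¹ * 3 = 1 := by
      rw [← map_ofNat (algebraMap k (Slam k lam)), ← map_mul,
        inv_mul_cancel₀ (by norm_num), map_one]
    have : x lam 1 ^ 2 = algebraMap k _ 3⁻¹ * (2 * (3 * x lam 0 * x lam 2 - algebraMap k _ lam)
        - algebraMap k _ lam) := by
      linear_combination (-2 * x lam 0 * x lam 2 + algebraMap k _ lam) * h3 -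
        relation (lam := lam)
    rw [this]
    exact mul_mem (algebraMap_mem _ _)
      (sub_mem (mul_mem (ofNat_mem _ 2) h02) (algebraMap_mem _ _))
  have hndvd : ¬ (⟨_, h00⟩ : Qlam k lam) ∣ ⟨_, h01⟩ := by
    rintro ⟨⟨r, hr⟩, h⟩
    have h' : x lam 0 * x lam 1 = x lam 0 ^ 2 * r := congrArg Subtype.val h
    rw [pow_two, mul_assoc] at h'
    have h1 := mul_left_cancel₀ (x_zero_ne_zero hlam) h'
    obtain ⟨c, hc⟩ := exists_sq_algebraicClosure lam
    have h2 := congrArg (fibre hc) h1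
    simp only [map_mul, fibre_x_zero, fibre_x_one, zero_mul, Polynomial.C_eq_zero] at h2
    rw [h2] at hc
    simp [hlam] at hc
  refine not_isUFDRing_of_irreducible (irreducible_of_coe_eq hlam (q := ⟨_, h00⟩) rfl)
    (a := ⟨_, h01⟩) (b := ⟨_, h01⟩) ⟨⟨_, h11⟩, Subtype.ext ?_⟩ hndvd hndvd
  simp only [MulMemClass.coe_mul]
  ring

end Qlam

namespace coneRNC

variable {k : Type*} [Field k]

theorem isUFDRing_one : IsUFDRing (coneRNC k 1) := by
  have htop : coneRNC k 1 = ⊤ := by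
    rw [eq_top_iff, ← adjoin_range_X, coneRNC]
    refine Algebra.adjoin_mono ?_
    rintro _ ⟨i, rfl⟩
    fin_cases i
    · exact ⟨1, le_rfl, by simp⟩
    · exact ⟨0, zero_le_one, by simp⟩
  let e : MvPolynomial (Fin 2) k ≃ₐ[k] coneRNC k 1 :=
    Subalgebra.topEquiv.symm.trans (Subalgebra.equivOfEq _ _ htop.symm)
  exact ⟨inferInstance, e.toMulEquiv.uniqueFactorizationMonoid inferInstance⟩

theorem monomial_mem {d i j : ℕ} (h : i + j = d) :
    (X 0 ^ i * X 1 ^ j : MvPolynomial (Fin 2) k) ∈ coneRNC k d :=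
  Algebra.subset_adjoin ⟨i, by omega, by rw [← h, Nat.add_sub_cancel_left]⟩

theorem dvd_of_pow_mem {d i : ℕ} (hd : 0 < d)
    (h : (X 0 ^ i : MvPolynomial (Fin 2) k) ∈ coneRNC k d) : d ∣ i := by
  have hle : coneRNC k d ≤ (Polynomial.expand k d).range.comap
      (aeval fun _ => (Polynomial.X : Polynomial k)) := by
    rw [coneRNC, Algebra.adjoin_le_iff]
    rintro _ ⟨i, hi, rfl⟩
    refine ⟨Polynomial.X, ?_⟩
    simp [← pow_add, Nat.add_sub_cancel' hi]
  obtain ⟨g, hg⟩ := hle h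
  by_contra hnd
  have h1 := congrArg (fun r => Polynomial.coeff r i) hg
  change (Polynomial.expand k d g).coeff i =
    (aeval (fun _ : Fin 2 => (Polynomial.X : Polynomial k)) (X 0 ^ i)).coeff i at h1
  rw [Polynomial.coeff_expand hd, if_neg hnd] at h1
  simp at h1

theorem irreducible_of_coe_eq {d : ℕ} (hd : 0 < d) {q : coneRNC k d}
    (hq : (q : MvPolynomial (Fin 2) k) = X 0 ^ d) : Irreducible q := by
  have hX := X_prime (R := k) (i := (0 : Fin 2))
  refine ⟨fun h => ?_, fun {a b} hab => ?_⟩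
  · have := h.map (coneRNC k d).val
    rw [Subalgebra.val_apply, hq, isUnit_pow_iff hd.ne'] at this
    exact hX.not_isUnit this
  have hab' : (a * b : MvPolynomial (Fin 2) k) = X 0 ^ d := by
    rw [← hq, hab]
    rfl
  have key : ∀ a b : coneRNC k d, (a * b : MvPolynomial (Fin 2) k) = X 0 ^ d →
      IsUnit a ∨ X 0 ^ d ∣ (a : MvPolynomial (Fin 2) k) := by
    intro a b hab
    obtain ⟨i, -, hi⟩ := (dvd_prime_pow hX _).1 ⟨_, hab.symm⟩
    obtain ⟨u, hu⟩ := hi.symm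
    obtain ⟨c, hc, huc⟩ := isUnit_iff_eq_C_of_isReduced.1 u.isUnit
    rw [huc] at hu
    rcases i.eq_zero_or_pos with rfl | hi
    · left
      have : a = algebraMap k _ c := Subtype.ext (by rw [← hu, pow_zero, one_mul]; rfl)
      rw [this]
      exact hc.map _
    · right
      rw [← hu]
      refine (pow_dvd_pow _ (Nat.le_of_dvd hi (dvd_of_pow_mem (k := k) hd ?_))).mul_right _
      have h1 : X 0 ^ i = C c⁻¹ * (a : MvPolynomial (Fin 2) k) := by
        rw [← hu, mul_left_comm, ← C_mul, inv_mul_cancel₀ hc.ne_zero, C_1, mul_one]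
      rw [h1]
      exact mul_mem ((coneRNC k d).algebraMap_mem c⁻¹) a.2
  rcases key a b hab' with h | ⟨r, hr⟩
  · exact Or.inl h
  rcases key b a ((mul_comm _ _).trans hab') with h | ⟨s, hs⟩
  · exact Or.inr h
  exfalso
  refine hX.not_isUnit ((isUnit_pow_iff hd.ne').1 (IsUnit.of_mul_eq_one (r * s) ?_))
  refine mul_left_cancel₀ (pow_ne_zero d hX.ne_zero) ?_
  rw [mul_one]
  conv_rhs => rw [← hab', hr, hs]
  ring

theorem not_isUFDRing {d : ℕ} (hd : 2 ≤ d) : ¬ IsUFDRing (coneRNC k d) := by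
  obtain ⟨e, rfl⟩ := Nat.exists_eq_add_of_le' hd
  have h0 : (X 0 ^ (e + 2) : MvPolynomial (Fin 2) k) ∈ coneRNC k (e + 2) := by
    simpa using monomial_mem (k := k) (add_zero (e + 2))
  have h1 : (X 0 ^ (e + 1) * X 1 ^ 1 : MvPolynomial (Fin 2) k) ∈ coneRNC k (e + 2) :=
    monomial_mem rfl
  have h2 : (X 0 ^ e * X 1 ^ 2 : MvPolynomial (Fin 2) k) ∈ coneRNC k (e + 2) := monomial_mem rfl
  have hndvd : ¬ (⟨_, h0⟩ : coneRNC k (e + 2)) ∣ ⟨_, h1⟩ := by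
    rintro ⟨⟨r, hr⟩, h⟩
    have h' : X 0 ^ (e + 1) * X 1 ^ 1 = X 0 ^ (e + 2) * r := congrArg Subtype.val h
    rw [pow_succ _ (e + 1), mul_assoc] at h'
    have h3 := mul_left_cancel₀ (pow_ne_zero _ (X_ne_zero (0 : Fin 2))) h'
    have h4 := congrArg (eval ![0, 1]) h3
    simp at h4
  refine not_isUFDRing_of_irreducible (irreducible_of_coe_eq (by omega) (q := ⟨_, h0⟩) rfl)
    (a := ⟨_, h1⟩) (b := ⟨_, h1⟩) ⟨⟨_, h2⟩, Subtype.ext ?_⟩ hndvd hndvd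
  simp only [MulMemClass.coe_mul]
  ring

end coneRNC

section Gluing

variable {k B A Ω : Type*} [Field k] [CommRing B] [Algebra k B] [CommRing A] [Algebra k A]
  [CommRing Ω] [Algebra k Ω]

theorem nonempty_algEquiv_adjoin {s : Set B} {t : Set A} (hs : Algebra.adjoin k s = ⊤)
    {φ : B →ₐ[k] Ω} {θ : A →ₐ[k] Ω} (hφ : Function.Injective φ) (hθ : Function.Injective θ)
    (hst : ∀ b ∈ s, φ b ∈ (Algebra.adjoin k t).map θ) (hts : ∀ a ∈ t, θ a ∈ φ.range) :
    Nonempty (B ≃ₐ[k] Algebra.adjoin k t) := by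
  have h : φ.range = (Algebra.adjoin k t).map θ := by
    refine le_antisymm ?_ ?_
    · rw [← Algebra.map_top, ← hs, AlgHom.map_adjoin, Algebra.adjoin_le_iff]
      rintro _ ⟨b, hb, rfl⟩
      exact hst b hb
    · rw [AlgHom.map_adjoin, Algebra.adjoin_le_iff]
      rintro _ ⟨a, ha, rfl⟩
      exact hts a ha
  exact ⟨(AlgEquiv.ofInjective φ hφ).trans ((Subalgebra.equivOfEq _ _ h).trans
    ((Algebra.adjoin k t).equivMapOfInjective θ hθ).symm)⟩

theorem Derivation.mem_adjoin {s : Set B} (U : Derivation k B B)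
    (hs : ∀ x ∈ s, U x ∈ Algebra.adjoin k s) {x : B} (hx : x ∈ Algebra.adjoin k s) :
    U x ∈ Algebra.adjoin k s := by
  induction hx using Algebra.adjoin_induction with
  | mem x hx => exact hs x hx
  | algebraMap c => rw [U.map_algebraMap]; exact zero_mem _
  | add x y _ _ hx hy => rw [map_add]; exact add_mem hx hy
  | mul x y hx hy hUx hUy =>
    rw [U.leibniz]
    exact add_mem (mul_mem hx hUy) (mul_mem hy hUx)

theorem AlgebraicIndependent.of_mem_adjoin [IsDomain Ω] {ι : Type*} [Finite ι] {x y : ι → Ω}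
    (hy : AlgebraicIndependent k y) (h : ∀ i, y i ∈ Algebra.adjoin k (Set.range x)) :
    AlgebraicIndependent k x := by
  have hex : ∀ i, ∃ g : MvPolynomial ι k, aeval x g = y i := fun i => by
    have := h i
    rwa [Algebra.adjoin_range_eq_range_aeval] at this
  choose g hg using hex
  have hxg : aeval x ∘ g = y := funext hg
  have hgi : AlgebraicIndependent k g := by
    refine AlgebraicIndependent.of_comp (aeval x : MvPolynomial ι k →ₐ[k] Ω) ?_
    rwa [hxg]
  have hb : IsTranscendenceBasis k g :=
    hgi.isTranscendenceBasis_of_lift_trdeg_le_of_finite (by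
      rw [MvPolynomial.trdeg_of_isDomain]
      simp)
  have halg := hb.isAlgebraic
  have hcomp : (aeval x).comp (aeval g) = (aeval y : MvPolynomial ι k →ₐ[k] Ω) := by
    ext i
    simp [hg]
  rw [AlgebraicIndependent, injective_iff_map_eq_zero]
  intro f hf
  by_contra hf0
  have hne := Ideal.comap_ne_bot_of_algebraic_mem hf0
    (I := RingHom.ker (aeval x : MvPolynomial ι k →ₐ[k] Ω)) hf
    (halg.isAlgebraic f)
  obtain ⟨⟨a, ha⟩, haker, ha0⟩ := Submodule.exists_mem_ne_zero_of_ne_bot hne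
  rw [Algebra.adjoin_range_eq_range_aeval] at ha
  obtain ⟨q, rfl⟩ := ha
  have h1 : aeval y q = 0 := by
    rw [← hcomp]
    exact haker
  refine ha0 (Subtype.ext ?_)
  change aeval g q = 0
  rw [(injective_iff_map_eq_zero _).1 hy q h1, map_zero]

theorem algebraicIndependent_of_embedding [IsDomain Ω]
    {φ : B →ₐ[k] Ω} (hφ : Function.Injective φ) {h p : B}
    (hind : AlgebraicIndependent k ![h, p]) {y z : Ω}
    (hh : φ h ∈ Algebra.adjoin k {y, z}) (hp : φ p ∈ Algebra.adjoin k {y, z}) :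
    AlgebraicIndependent k ![y, z] := by
  refine (hind.map' hφ).of_mem_adjoin fun i => ?_
  rw [Matrix.range_cons, Matrix.range_cons, Matrix.range_empty, Set.union_empty,
    Set.singleton_union]
  fin_cases i
  · exact hh
  · exact hp

end Gluing

section Classification

variable {k B : Type*} [Field k] [CommRing B] [Algebra k B]

/-- An algebraically closed field containing `B`. -/
theorem exists_algClosed_embedding [IsDomain B] : ∃ φ : B →ₐ[k] AlgebraicClosure (FractionRing B),
    Function.Injective φ :=
  ⟨(IsScalarTower.toAlgHom k (FractionRing B) _).comp (IsScalarTower.toAlgHom k B _),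
    (algebraMap (FractionRing B) _).injective.comp (IsFractionRing.injective B _)⟩

variable {U : Derivation k B B} {n : ℕ} {h p : B}

theorem iterate_mul_pow (hUh : U h = n * p)
    (hUp : h * U p = (n - 1) * p ^ 2) {i : ℕ} (hi : i ≤ n) :
    U^[i] h * h ^ i = (n.descFactorial i : B) * h * p ^ i := by
  induction i with
  | zero => simp
  | succ i ih =>
    have ih := ih (by omega)
    have h1 : h * U (h ^ i) = i * h ^ i * (n * p) := by
      rw [U.leibniz_pow, hUh]
      cases i with
      | zero => simp
      | succ i =>
        rw [Nat.add_sub_cancel, nsmul_eq_mul, smul_eq_mul]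
        ring
    have h2 : h * U (p ^ i) = i * (n - 1) * p ^ (i + 1) := by
      rw [U.leibniz_pow]
      cases i with
      | zero => simp
      | succ i =>
        rw [Nat.add_sub_cancel, nsmul_eq_mul, smul_eq_mul]
        linear_combination ((i + 1 : ℕ) : B) * p ^ i * hUp
    have h3 := congrArg U ih
    rw [U.leibniz, U.leibniz, U.leibniz, U.map_natCast, hUh, ← Function.iterate_succ_apply' U] at h3
    simp only [smul_eq_mul, mul_zero] at h3
    rw [Nat.descFactorial_succ, Nat.cast_mul, Nat.cast_sub (by omega)]
    linear_combination h * h3 - U^[i] h * h1 + (n.descFactorial i : B) * h * h2 - i * n * p * ih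

variable [CharZero k] [IsDomain B]

theorem nonempty_algEquiv_coneRNC (hn : 0 < n) (h0 : h ≠ 0)
    (hind : AlgebraicIndependent k ![h, p]) (hUh : U h = n * p) (hUn : U^[n + 1] h = 0)
    (htop : ∀ S : Subalgebra k B, h ∈ S → (∀ x ∈ S, U x ∈ S) → S = ⊤)
    (hUp : h * U p = (n - 1) * p ^ 2) : Nonempty (B ≃ₐ[k] coneRNC k n) := by
  obtain ⟨φ, hφ⟩ := exists_algClosed_embedding (k := k) (B := B)
  obtain ⟨y, hy⟩ := IsAlgClosed.exists_pow_nat_eq (φ h) hn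
  have hφ0 : φ h ≠ 0 := by rwa [Ne, map_eq_zero_iff _ hφ]
  have hy0 : y ≠ 0 := by
    rintro rfl
    exact hφ0 (by rw [← hy, zero_pow hn.ne'])
  obtain ⟨z, hz⟩ : ∃ z, y * φ p = φ h * z := ⟨y * φ p / φ h, by field_simp⟩
  have hiter : ∀ i j, i + j = n → φ (U^[i] h) = (n.descFactorial i : k) • (y ^ j * z ^ i) := by
    intro i j hij
    have h1 := congrArg φ (iterate_mul_pow hUh hUp (i := i) (by omega))
    simp only [map_mul, map_pow, map_natCast] at h1
    have h2 : y ^ i * φ p ^ i = φ h ^ i * z ^ i := by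
      rw [← mul_pow, hz, mul_pow]
    have h3 : φ h = y ^ i * y ^ j := by
      rw [← hy, ← hij, pow_add]
    rw [Nat.cast_smul_eq_nsmul, nsmul_eq_mul]
    refine mul_right_cancel₀ (pow_ne_zero i hφ0) (mul_right_cancel₀ (pow_ne_zero i hy0) ?_)
    rw [h1]
    linear_combination (n.descFactorial i : AlgebraicClosure (FractionRing B)) * φ h * h2 +
      (n.descFactorial i : AlgebraicClosure (FractionRing B)) * φ h ^ i * z ^ i * h3
  have hp : φ p = y ^ (n - 1) * z := by
    refine mul_left_cancel₀ hy0 ?_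
    rw [hz, ← hy, ← mul_assoc, mul_pow_sub_one hn.ne']
  have hymem : y ∈ Algebra.adjoin k {y, z} := Algebra.subset_adjoin (by simp)
  have hzmem : z ∈ Algebra.adjoin k {y, z} := Algebra.subset_adjoin (by simp)
  have hyz : AlgebraicIndependent k ![y, z] := algebraicIndependent_of_embedding hφ hind
    (by rw [← hy]; exact pow_mem hymem n) (by rw [hp]; exact mul_mem (pow_mem hymem _) hzmem)
  have hs : Algebra.adjoin k {b | ∃ i, i ≤ n ∧ b = U^[i] h} = ⊤ := by
    refine htop _ (Algebra.subset_adjoin ⟨0, Nat.zero_le n, rfl⟩) fun x hx => U.mem_adjoin ?_ hx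
    rintro _ ⟨i, hi, rfl⟩
    rw [← Function.iterate_succ_apply' U]
    rcases hi.lt_or_eq with hi | rfl
    · exact Algebra.subset_adjoin ⟨i + 1, hi, rfl⟩
    · rw [hUn]
      exact zero_mem _
  refine nonempty_algEquiv_adjoin hs hφ hyz ?_ ?_
  · rintro _ ⟨i, hi, rfl⟩
    rw [hiter i (n - i) (by omega)]
    refine Subalgebra.smul_mem _ ?_ _
    refine ⟨X 0 ^ (n - i) * X 1 ^ i, coneRNC.monomial_mem (by omega), ?_⟩
    simp
  · rintro _ ⟨i, hi, rfl⟩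
    have hd : (n.descFactorial (n - i) : k) ≠ 0 := by
      rw [Nat.cast_ne_zero, Ne, Nat.descFactorial_eq_zero_iff_lt]
      omega
    refine ⟨(n.descFactorial (n - i) : k)⁻¹ • U^[n - i] h, ?_⟩
    change φ _ = _
    rw [map_smul, hiter (n - i) i (by omega), smul_smul, inv_mul_cancel₀ hd, one_smul]
    simp

theorem nonempty_algEquiv_Slam {lam : k} (hlam : lam ≠ 0)
    (hind : AlgebraicIndependent k ![h, p]) (hUh : U h = 2 * p) (hUn : U^[3] h = 0)
    (htop : ∀ S : Subalgebra k B, h ∈ S → (∀ x ∈ S, U x ∈ S) → S = ⊤)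
    (hUp : h * U p = p ^ 2 + algebraMap k B lam) : Nonempty (B ≃ₐ[k] Slam k lam) := by
  have : CharZero B := charZero_of_injective_algebraMap (algebraMap k B).injective
  have h2 : algebraMap k B 2⁻¹ * 2 = 1 := by
    rw [← map_ofNat (algebraMap k B), ← map_mul, inv_mul_cancel₀ two_ne_zero, map_one]
  have hU2 : U 2 = 0 := U.map_natCast 2
  have hUUp : U (U p) = 0 := by
    have h3 : U (U (U h)) = 0 := hUn
    rw [hUh, U.leibniz, hU2, smul_zero, add_zero, smul_eq_mul, U.leibniz, hU2, smul_zero, add_zero,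
      smul_eq_mul] at h3
    exact (mul_eq_zero.1 h3).resolve_left two_ne_zero
  let a : Fin 3 → B := ![h, p, algebraMap k B 2⁻¹ * U p]
  have ha : 2 * a 0 * a 2 = a 1 ^ 2 + algebraMap k B lam := by
    change 2 * h * (algebraMap k B 2⁻¹ * U p) = p ^ 2 + algebraMap k B lam
    linear_combination h * U p * h2 + hUp
  have hmem : ∀ i, a i ∈ Algebra.adjoin k (Set.range a) := fun i => Algebra.subset_adjoin ⟨i, rfl⟩
  have hrange : (Slam.lift a ha).range = ⊤ := by
    rw [Slam.range_lift]
    refine htop _ (hmem 0) fun x hx => U.mem_adjoin ?_ hx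
    rintro _ ⟨i, rfl⟩
    fin_cases i
    · change U h ∈ _
      rw [hUh]
      exact mul_mem (ofNat_mem _ 2) (hmem 1)
    · change U p ∈ _
      have : U p = 2 * a 2 := by
        change U p = 2 * (algebraMap k B 2⁻¹ * U p)
        linear_combination -U p * h2
      rw [this]
      exact mul_mem (ofNat_mem _ 2) (hmem 2)
    · change U (algebraMap k B 2⁻¹ * U p) ∈ _
      rw [U.leibniz, hUUp, U.map_algebraMap]
      simp
  exact ⟨(AlgEquiv.ofBijective (Slam.lift a ha) ⟨Slam.lift_injective hlam a ha hind,
    (AlgHom.range_eq_top _).1 hrange⟩).symm⟩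

theorem nonempty_algEquiv_Qlam {lam : k} (hlam : lam ≠ 0) (h0 : h ≠ 0)
    (hind : AlgebraicIndependent k ![h, p]) (hUh : U h = 4 * p) (hUn : U^[5] h = 0)
    (htop : ∀ S : Subalgebra k B, h ∈ S → (∀ x ∈ S, U x ∈ S) → S = ⊤)
    (hUp : h * U p = 3 * p ^ 2 + algebraMap k B lam * h) : Nonempty (B ≃ₐ[k] Qlam k lam) := by
  have : CharZero B := charZero_of_injective_algebraMap (algebraMap k B).injective
  obtain ⟨φ, hφ⟩ := exists_algClosed_embedding (k := k) (B := B)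
  have hΩ : CharZero (AlgebraicClosure (FractionRing B)) :=
    charZero_of_injective_algebraMap (algebraMap k _).injective
  have hU2 : U 2 = 0 := U.map_natCast 2
  have hU3 : U 3 = 0 := U.map_natCast 3
  have hU4 : U 4 = 0 := U.map_natCast 4
  obtain ⟨q₁, hq₁⟩ : ∃ q, U p = q := ⟨_, rfl⟩
  obtain ⟨q₂, hq₂⟩ : ∃ q, U q₁ = q := ⟨_, rfl⟩
  obtain ⟨q₃, hq₃⟩ : ∃ q, U q₂ = q := ⟨_, rfl⟩
  have hU4' : ∀ f, U (4 * f) = 4 * U f := fun f => by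
    rw [U.leibniz, hU4]
    simp
  have hUq₃ : U q₃ = 0 := by
    have h1 : U (U (U (U (U h)))) = 0 := hUn
    rw [hUh, hU4', hq₁, hU4', hq₂, hU4', hq₃, hU4'] at h1
    exact (mul_eq_zero.1 h1).resolve_left (OfNat.ofNat_ne_zero 4)
  have e₁ : h * q₁ = 3 * p ^ 2 + algebraMap k B lam * h := by rw [← hUp, hq₁]
  have e₂ : h * q₂ = 2 * p * q₁ + 4 * algebraMap k B lam * p := by
    have := congrArg U e₁
    simp only [map_add, Derivation.leibniz, Derivation.leibniz_pow, U.map_algebraMap, hU3, hUh,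
      hq₁, hq₂, smul_eq_mul, nsmul_eq_mul] at this
    push_cast at this
    linear_combination this
  have e₃ : h * q₃ = 2 * q₁ ^ 2 - 2 * p * q₂ + 4 * algebraMap k B lam * q₁ := by
    have := congrArg U e₂
    simp only [map_add, Derivation.leibniz, U.map_algebraMap, hU2, hU4, hUh,
      hq₁, hq₂, hq₃, smul_eq_mul] at this
    linear_combination this
  obtain ⟨y, hy⟩ := IsAlgClosed.exists_pow_nat_eq (φ h) two_pos
  have hφ0 : φ h ≠ 0 := by rwa [Ne, map_eq_zero_iff _ hφ]
  have hy0 : y ≠ 0 := by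
    rintro rfl
    exact hφ0 (by rw [← hy, zero_pow two_ne_zero])
  obtain ⟨z, hz⟩ : ∃ z, y * z = φ p := ⟨φ p / y, mul_div_cancel₀ _ hy0⟩
  obtain ⟨w, hw⟩ : ∃ w, 2 * y * w = z ^ 2 + algebraMap k _ lam :=
    ⟨(z ^ 2 + algebraMap k _ lam) / (2 * y), mul_div_cancel₀ _ (mul_ne_zero two_ne_zero hy0)⟩
  have hymem : y ∈ Algebra.adjoin k {y, z} := Algebra.subset_adjoin (by simp)
  have hzmem : z ∈ Algebra.adjoin k {y, z} := Algebra.subset_adjoin (by simp)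
  have hyz : AlgebraicIndependent k ![y, z] := algebraicIndependent_of_embedding hφ hind
    (by rw [← hy]; exact pow_mem hymem 2) (by rw [← hz]; exact mul_mem hymem hzmem)
  have f₁ : φ q₁ = 2 * (3 * y * w - algebraMap k _ lam) := by
    have := congrArg φ e₁
    simp only [map_mul, map_add, map_pow, map_ofNat, AlgHom.commutes, ← hy, ← hz] at this
    refine mul_left_cancel₀ (pow_ne_zero 2 hy0) ?_
    linear_combination this - 3 * y ^ 2 * hw
  have f₂ : φ q₂ = 12 * (z * w) := by
    have := congrArg φ e₂
    simp only [map_mul, map_add, map_ofNat, AlgHom.commutes, ← hy, ← hz, f₁] at this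
    refine mul_left_cancel₀ (pow_ne_zero 2 hy0) ?_
    linear_combination this
  have f₃ : φ q₃ = 24 * w ^ 2 := by
    have := congrArg φ e₃
    simp only [map_mul, map_add, map_sub, map_pow, map_ofNat, AlgHom.commutes, ← hy, ← hz, f₁,
      f₂] at this
    refine mul_left_cancel₀ (pow_ne_zero 2 hy0) ?_
    linear_combination this + 24 * y * w * hw
  have hs : Algebra.adjoin k {h, p, q₁, q₂, q₃} = ⊤ := by
    have hsub := Algebra.subset_adjoin (R := k) (s := {h, p, q₁, q₂, q₃})
    refine htop _ (hsub (by simp)) fun x hx => U.mem_adjoin ?_ hx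
    rintro _ (rfl | rfl | rfl | rfl | rfl)
    · rw [hUh]
      exact mul_mem (ofNat_mem _ 4) (hsub (by simp))
    · rw [hq₁]
      exact hsub (by simp)
    · rw [hq₂]
      exact hsub (by simp)
    · rw [hq₃]
      exact hsub (by simp)
    · rw [hUq₃]
      exact zero_mem _
  have hθ := Slam.lift_injective hlam ![y, z, w] hw hyz
  have hx₀ : Slam.lift ![y, z, w] hw (Slam.x lam 0) = y := Slam.lift_x _ _ _
  have hx₁ : Slam.lift ![y, z, w] hw (Slam.x lam 1) = z := Slam.lift_x _ _ _
  have hx₂ : Slam.lift ![y, z, w] hw (Slam.x lam 2) = w := Slam.lift_x _ _ _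
  have hx (n : ℕ) [n.AtLeastTwo] : Slam.lift ![y, z, w] hw ofNat(n) = ofNat(n) := map_ofNat _ n
  have hinv : ∀ (c : ℕ) (f : B) (g : AlgebraicClosure (FractionRing B)), c ≠ 0 →
      φ f = c * g → g ∈ φ.range := by
    intro c f g hc hf
    refine ⟨(c : k)⁻¹ • f, ?_⟩
    change φ _ = _
    rw [map_smul, hf, ← nsmul_eq_mul, ← Nat.cast_smul_eq_nsmul k, smul_smul,
      inv_mul_cancel₀ (Nat.cast_ne_zero.2 hc), one_smul]
  rw [Qlam.eq_adjoin]
  have hsub := Algebra.subset_adjoin (R := k) (s := {Slam.x lam 2 ^ 2, Slam.x lam 1 * Slam.x lam 2,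
    3 * Slam.x lam 0 * Slam.x lam 2 - algebraMap k _ lam, Slam.x lam 0 * Slam.x lam 1,
    Slam.x lam 0 ^ 2})
  refine nonempty_algEquiv_adjoin hs hφ hθ ?_ ?_
  · rintro _ (rfl | rfl | rfl | rfl | rfl)
    · exact ⟨Slam.x lam 0 ^ 2, hsub (by simp), by simp [hx₀, hy]⟩
    · exact ⟨Slam.x lam 0 * Slam.x lam 1, hsub (by simp), by simp [hx₀, hx₁, hz]⟩
    · exact ⟨2 * (3 * Slam.x lam 0 * Slam.x lam 2 - algebraMap k _ lam),
        mul_mem (ofNat_mem _ 2) (hsub (by simp)), by simp [hx, hx₀, hx₂, f₁]⟩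
    · exact ⟨12 * (Slam.x lam 1 * Slam.x lam 2), mul_mem (ofNat_mem _ 12) (hsub (by simp)),
        by simp [hx, hx₁, hx₂, f₂]⟩
    · exact ⟨24 * Slam.x lam 2 ^ 2, mul_mem (ofNat_mem _ 24) (hsub (by simp)),
        by simp [hx, hx₂, f₃]⟩
  · rintro _ (rfl | rfl | rfl | rfl | rfl)
    · exact hinv 24 q₃ _ (by norm_num) (by simp [hx₂, f₃])
    · exact hinv 12 q₂ _ (by norm_num) (by simp [hx₁, hx₂, f₂])
    · exact hinv 2 q₁ _ (by norm_num) (by simp [hx, hx₀, hx₂, f₁])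
    · exact hinv 1 p _ (by norm_num) (by simp [hx₀, hx₁, hz])
    · exact hinv 1 h _ (by norm_num) (by simp [hx₀, hy])

end Classification

/-- Classification Theorem: a normal two-dimensional affine `k`-domain `B`
with `B* = k*` admitting a nontrivial fundamental pair is isomorphic to some `k[F_d]`
(`d ≥ 1`), some `S_λ(k)`, or some `Q_λ(k)` (`λ ∈ k*`); among these rings the UFDs are
exactly `k[F_1] ≅ k^[2]` and the `S_λ(k)` for which `−λ` is not a square in `k`. -/
theorem stmt_13 {k B : Type*} [Field k] [CharZero k] [CommRing B] [IsDomain B] [Algebra k B]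
    [Algebra.FiniteType k B] [IsIntegrallyClosed B]
    (hdim : ringKrullDim B = 2)
    (hunits : ∀ b : Bˣ, ∃ c : kˣ, (b : B) = algebraMap k B (c : k))
    (D U : Derivation k B B) (hDU : IsFundamentalPair D U) (hnt : ¬(D = 0 ∧ U = 0)) :
    ((∃ d : ℕ, 1 ≤ d ∧ Nonempty (B ≃ₐ[k] ↥(coneRNC k d))) ∨
     (∃ lam : k, lam ≠ 0 ∧ Nonempty (B ≃ₐ[k] Slam k lam)) ∨
     (∃ lam : k, lam ≠ 0 ∧ Nonempty (B ≃ₐ[k] ↥(Qlam k lam)))) ∧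
    IsUFDRing ↥(coneRNC k 1) ∧
    (∀ d : ℕ, 2 ≤ d → ¬ IsUFDRing ↥(coneRNC k d)) ∧
    (∀ lam : k, lam ≠ 0 → (IsUFDRing (Slam k lam) ↔ ¬ ∃ c : k, c ^ 2 = -lam)) ∧
    (∀ lam : k, lam ≠ 0 → ¬ IsUFDRing ↥(Qlam k lam)) := by
  refine ⟨?_, coneRNC.isUFDRing_one, fun d => coneRNC.not_isUFDRing,
    fun lam => Slam.isUFDRing_iff, fun lam => Qlam.not_isUFDRing⟩
  have htr : Algebra.trdeg k B ≤ 2 := by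
    exact_mod_cast trdeg_le_of_ringKrullDim_eq (k := k) (B := B) (n := 2) (by exact_mod_cast hdim)
  obtain ⟨n, h, p, hn, h0, hind, hUh, hUn, htop, hUp | ⟨c, hc, rfl, hUp⟩ | ⟨c, hc, rfl, hUp⟩⟩ :=
    exists_structure htr hunits hDU hnt
  · exact Or.inl ⟨n, hn, nonempty_algEquiv_coneRNC hn h0 hind hUh hUn htop hUp⟩
  · exact Or.inr (Or.inl ⟨c, hc, nonempty_algEquiv_Slam hc hind (by exact_mod_cast hUh) hUn htop hUp⟩)
  · exact Or.inr (Or.inr ⟨c, hc,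
      nonempty_algEquiv_Qlam hc h0 hind (by exact_mod_cast hUh) hUn htop hUp⟩)
end

section
/- Let B be an affine k-domain with fundamental pair (D,U) and let B[t] ≅ B^[1]. Then every extension of (D,U) to a fundamental pair (D',U') of B[t] (i.e., a fundamental pair with D'|_B = D and U'|_B = U) is trivial: there exists s ∈ B[t] such that B[t] = B[s] and D's = U's = 0. -/
open Polynomial

/-- The general Leibniz rule for derivations. -/
theorem Derivation.pow_apply_mul {k B : Type*} [CommRing k] [CommRing B] [Algebra k B]
    (D : Derivation k B B) (n : ℕ) (a b : B) :
    (D.toLinearMap ^ n) (a * b) = ∑ ij ∈ Finset.HasAntidiagonal.antidiagonal n,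
      n.choose ij.1 • ((D.toLinearMap ^ ij.1) a * (D.toLinearMap ^ ij.2) b) := by
  induction n with
  | zero => simp
  | succ n ih =>
    rw [Finset.sum_antidiagonal_choose_succ_nsmul
      (fun i j => (D.toLinearMap ^ i) a * (D.toLinearMap ^ j) b) n, pow_succ',
      Module.End.mul_apply, ih, map_sum, ← Finset.sum_add_distrib]
    refine Finset.sum_congr rfl fun ij hij => ?_
    rw [Finset.HasAntidiagonal.mem_antidiagonal] at hij
    rw [Nat.choose_symm_of_eq_add hij.symm, map_nsmul, ← nsmul_add]
    congr 1
    simp only [pow_succ', Module.End.mul_apply, Derivation.coeFn_coe, Derivation.leibniz,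
      smul_eq_mul]
    ring

/-- A nonzero element on which a locally nilpotent operator acts has a largest power not
annihilating it. -/
theorem exists_pow_apply_ne_zero_of_locally_nilpotent {k V : Type*} [Semiring k]
    [AddCommMonoid V] [Module k V] {f : Module.End k V} {v : V} (hv : v ≠ 0)
    (h : ∃ n : ℕ, (f ^ n) v = 0) :
    ∃ n : ℕ, (f ^ n) v ≠ 0 ∧ ∀ m, n < m → (f ^ m) v = 0 := by
  classical
  obtain ⟨n, hn⟩ : ∃ n, Nat.find h = n + 1 :=
    Nat.exists_eq_succ_of_ne_zero fun h0 => hv <| by simpa [h0] using Nat.find_spec h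
  refine ⟨n, Nat.find_min h (by lia), fun m hm => ?_⟩
  obtain ⟨j, rfl⟩ := Nat.exists_eq_add_of_le' (show n + 1 ≤ m from hm)
  have := Nat.find_spec h
  rw [hn] at this
  rw [pow_add, Module.End.mul_apply, this, map_zero]

/-- If a locally nilpotent derivation of a domain sends `c` to a multiple of `c`, then it
kills `c`. -/
theorem IsLND.eq_zero_of_apply_eq_mul {k B : Type*} [CommRing k] [CommRing B] [IsDomain B]
    [CharZero B] [Algebra k B] {D : Derivation k B B} (hD : IsLND D) {g c : B} (hc : c ≠ 0)
    (h : D c = g * c) : g = 0 := by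
  by_contra hg
  obtain ⟨m, hm, hm'⟩ := exists_pow_apply_ne_zero_of_locally_nilpotent hg (hD g)
  obtain ⟨n, hn, hn'⟩ := exists_pow_apply_ne_zero_of_locally_nilpotent hc (hD c)
  have key : (D.toLinearMap ^ (m + n)) (g * c) = 0 := by
    rw [← h]
    have := hn' (m + n + 1) (by lia)
    rwa [pow_succ, Module.End.mul_apply] at this
  rw [D.pow_apply_mul, Finset.sum_eq_single (m, n)] at key
  · rw [nsmul_eq_mul] at key
    refine mul_ne_zero ?_ (mul_ne_zero hm hn) key
    exact_mod_cast (Nat.choose_pos (Nat.le_add_right m n)).ne'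
  · rintro ⟨i, j⟩ hij hne
    rw [Finset.HasAntidiagonal.mem_antidiagonal] at hij
    rcases lt_trichotomy i m with hi | rfl | hi
    · simp [hn' j (by simp only at hij; lia)]
    · exact absurd (by simp only at hij; congr 1; lia) hne
    · simp [hm' i hi]
  · simp

/-- The coefficients of the image of a polynomial under a derivation that extends a derivation
of the coefficient ring. -/
theorem coeff_derivation_apply {k B : Type*} [CommRing k] [CommRing B] [Algebra k B]
    {D : Derivation k B B} {D' : Derivation k B[X] B[X]} (h : ∀ b : B, D' (C b) = C (D b))
    (p : B[X]) (i : ℕ) :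
    (D' p).coeff i = D (p.coeff i) + (derivative p * D' X).coeff i := by
  induction p using Polynomial.induction_on' with
  | add p q hp hq => simp only [map_add, coeff_add, hp, hq, add_mul]; ring
  | monomial n a =>
    rw [← C_mul_X_pow_eq_monomial, Derivation.leibniz, Derivation.leibniz_pow, h]
    simp only [smul_eq_mul, coeff_add, derivative_C_mul_X_pow, coeff_C_mul_X_pow, nsmul_eq_mul]
    rw [add_comm]
    congr 1
    · rw [mul_comm, coeff_C_mul_X_pow]
      split_ifs <;> simp
    · congr 1
      simp only [map_mul, map_natCast]
      ring

/-- A locally nilpotent derivation of `B[X]` extending a derivation of `B` maps `X` into `B`. -/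
theorem IsLND.exists_apply_X_eq_C {k B : Type*} [CommRing k] [CommRing B] [IsDomain B]
    [CharZero B] [Algebra k B] {D : Derivation k B B} {D' : Derivation k B[X] B[X]}
    (hD : IsLND D) (hD' : IsLND D') (h : ∀ b : B, D' (C b) = C (D b)) :
    ∃ b : B, D' X = C b := by
  obtain ⟨N, hN⟩ := hD' X
  have hdeg : (D' X).natDegree ≤ 1 := by
    by_contra! hlt
    have hstep (n : ℕ) : 1 ≤ ((D'.toLinearMap ^ n) X).natDegree := by
      induction n with
      | zero => simp
      | succ n ih =>
        rw [pow_succ', Module.End.mul_apply]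
        set p := (D'.toLinearMap ^ n) X
        obtain ⟨m, hm⟩ := Nat.exists_eq_add_of_le' ih
        suffices (D' p).coeff (m + (D' X).natDegree) ≠ 0 from
          le_trans (by lia) (le_natDegree_of_ne_zero this)
        rw [coeff_derivation_apply h, coeff_eq_zero_of_natDegree_lt (by lia), map_zero, zero_add,
          coeff_mul_add_eq_of_natDegree_le ((natDegree_derivative_le p).trans (by lia)) le_rfl,
          coeff_derivative, ← hm]
        refine mul_ne_zero (mul_ne_zero ?_ (by exact_mod_cast m.succ_ne_zero)) ?_
        · exact leadingCoeff_ne_zero.2 (by rintro h0; simp [h0] at ih)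
        · exact leadingCoeff_ne_zero.2 (by rintro h0; simp [h0] at hlt)
    have := hstep N
    simp [hN] at this
  set a := (D' X).coeff 1 with ha
  have hcoeff (p : B[X]) (hp : p.natDegree ≤ 1) :
      (D' p).natDegree ≤ 1 ∧ (D' p).coeff 1 = D (p.coeff 1) + p.coeff 1 * a := by
    have hder : derivative p = C (p.coeff 1) := by
      conv_lhs => rw [eq_X_add_C_of_natDegree_le_one hp]
      simp
    refine ⟨natDegree_le_iff_coeff_eq_zero.2 fun i hi => ?_, ?_⟩
    · rw [coeff_derivation_apply h, hder, coeff_C_mul, coeff_eq_zero_of_natDegree_lt (hp.trans_lt hi),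
        coeff_eq_zero_of_natDegree_lt (hdeg.trans_lt hi)]
      simp
    · rw [coeff_derivation_apply h, hder, coeff_C_mul]
  have hle (n : ℕ) : ((D'.toLinearMap ^ n) X).natDegree ≤ 1 := by
    induction n with
    | zero => simp
    | succ n ih => rw [pow_succ', Module.End.mul_apply]; exact (hcoeff _ ih).1
  have hex : ∃ n, ((D'.toLinearMap ^ n) X).coeff 1 = 0 := ⟨N, by simp [hN]⟩
  classical
  obtain ⟨n, hn⟩ : ∃ n, Nat.find hex = n + 1 :=
    Nat.exists_eq_succ_of_ne_zero fun h0 => by simpa [h0] using Nat.find_spec hex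
  have hmin := Nat.find_min hex (show n < _ by lia)
  have hspec := Nat.find_spec hex
  rw [hn, pow_succ', Module.End.mul_apply, Derivation.coeFn_coe, (hcoeff _ (hle n)).2] at hspec
  have ha0 : -a = 0 := hD.eq_zero_of_apply_eq_mul hmin (by linear_combination hspec)
  refine ⟨(D' X).coeff 0, ?_⟩
  conv_lhs => rw [eq_X_add_C_of_natDegree_le_one hdeg, ← ha, neg_eq_zero.1 ha0]
  simp

/-- The commutation rule `Eⁿ⁺¹ F = F Eⁿ⁺¹ + (n + 1)(w + n) Eⁿ` on vectors of weight `w`. -/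
theorem pow_succ_apply_of_weight {k V : Type*} [CommRing k] [AddCommGroup V] [Module k V]
    {E F H : Module.End k V} (hEF : ∀ v, E (F v) = F (E v) + H v)
    (hHE : ∀ v, H (E v) = E (H v) + (2 : k) • E v) {w : k} {v : V} (hv : H v = w • v) (n : ℕ) :
    (E ^ (n + 1)) (F v) = F ((E ^ (n + 1)) v) + ((n + 1) * (w + n) : k) • (E ^ n) v := by
  have hw (m : ℕ) : H ((E ^ m) v) = (w + 2 * m) • (E ^ m) v := by
    induction m with
    | zero => simp [hv]
    | succ m ih =>
      rw [pow_succ', Module.End.mul_apply, hHE, ih, map_smul, ← add_smul]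
      congr 1
      push_cast
      ring
  induction n with
  | zero => simp [hEF, hv]
  | succ n ih =>
    rw [pow_succ', Module.End.mul_apply, ih, map_add, hEF, map_smul, ← Module.End.mul_apply E (E ^ (n + 1)),
      ← Module.End.mul_apply E (E ^ n), ← pow_succ', ← pow_succ', hw, add_assoc, ← add_smul]
    congr 2
    push_cast
    ring

/-- On an operator whose integer eigenspaces span, `ker H² = ker H`. -/
theorem apply_eq_zero_of_apply_apply_eq_zero {k V : Type*} [Field k] [CharZero k]
    [AddCommGroup V] [Module k V] {H : Module.End k V}
    (hH : (⨆ d : ℤ, LinearMap.ker (H - d • (LinearMap.id : V →ₗ[k] V))) = ⊤) {x : V}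
    (hx : H (H x) = 0) : H x = 0 := by
  have key : ∃ q : k[X], q.eval 0 ≠ 0 ∧ aeval H q (H x) = 0 := by
    have hmem : x ∈ ⨆ d : ℤ, LinearMap.ker (H - d • (LinearMap.id : V →ₗ[k] V)) :=
      hH ▸ Submodule.mem_top
    clear hx
    induction hmem using Submodule.iSup_induction' with
    | mem d x hx =>
      have hd : H x = (d : k) • x := by
        rw [Int.cast_smul_eq_zsmul]
        simpa [sub_eq_zero] using hx
      rcases eq_or_ne d 0 with rfl | hd0
      · exact ⟨1, by simp, by simp [hd]⟩
      · refine ⟨X - C (d : k), by simpa using hd0, ?_⟩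
        rw [map_sub, aeval_X, aeval_C, LinearMap.sub_apply, hd, map_smul, hd,
          Module.algebraMap_end_apply, sub_self]
    | zero => exact ⟨1, by simp, by simp⟩
    | add x y _ _ hx hy =>
      obtain ⟨p, hp, hpx⟩ := hx
      obtain ⟨q, hq, hqy⟩ := hy
      refine ⟨p * q, by simp [hp, hq], ?_⟩
      have hx' : aeval H (p * q) (H x) = 0 := by
        rw [mul_comm, map_mul, Module.End.mul_apply, hpx, map_zero]
      have hy' : aeval H (p * q) (H y) = 0 := by
        rw [map_mul, Module.End.mul_apply, hqy, map_zero]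
      rw [map_add, map_add, hx', hy', add_zero]
  obtain ⟨q, hq, hqx⟩ := key
  have hev : Module.End.HasEigenvector H 0 (H x) ∨ H x = 0 := by
    by_cases h0 : H x = 0
    · exact Or.inr h0
    · exact Or.inl ⟨Module.End.mem_eigenspace_iff.2 (by simpa using hx), h0⟩
  rcases hev with hev | h0
  · rw [Module.End.aeval_apply_of_hasEigenvector hev] at hqx
    exact (smul_eq_zero.1 hqx).resolve_left hq
  · exact h0

/-- If the integer eigenspaces of `H` span, then every vector is, up to a vector killed by `H`,
in the image of `H`. -/
theorem exists_apply_sub_apply_eq_zero {k V : Type*} [Field k] [CharZero k]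
    [AddCommGroup V] [Module k V] {H : Module.End k V}
    (hH : (⨆ d : ℤ, LinearMap.ker (H - d • (LinearMap.id : V →ₗ[k] V))) = ⊤) (x : V) :
    ∃ y, H (x - H y) = 0 := by
  have hmem : x ∈ ⨆ d : ℤ, LinearMap.ker (H - d • (LinearMap.id : V →ₗ[k] V)) :=
    hH ▸ Submodule.mem_top
  induction hmem using Submodule.iSup_induction' with
  | mem d x hx =>
    have hd : H x = (d : k) • x := by
      rw [Int.cast_smul_eq_zsmul]
      simpa [sub_eq_zero] using hx
    rcases eq_or_ne d 0 with rfl | hd0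
    · exact ⟨0, by simp [hd]⟩
    · refine ⟨(d : k)⁻¹ • x, ?_⟩
      rw [map_smul, hd, inv_smul_smul₀ (by exact_mod_cast hd0), sub_self, map_zero]
  | zero => exact ⟨0, by simp⟩
  | add x y _ _ hx hy =>
    obtain ⟨u, hu⟩ := hx
    obtain ⟨v, hv⟩ := hy
    exact ⟨u + v, by rw [map_add, add_sub_add_comm, map_add, hu, hv, add_zero]⟩

/-- Let `E`, `F`, `H` satisfy the `sl₂` relations, with `E` and `F` locally nilpotent. If `x` has
weight zero and `E` maps `x` into an `F`-, `E`-stable subspace `W`, then a vector of `x + W`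
is killed by `E` and `F`. -/
theorem exists_mem_add_invariant {k V : Type*} [Field k] [CharZero k]
    [AddCommGroup V] [Module k V] {E F H : Module.End k V}
    (hE : ∀ v, ∃ n : ℕ, (E ^ n) v = 0) (hF : ∀ v, ∃ n : ℕ, (F ^ n) v = 0)
    (hEF : ∀ v, E (F v) = F (E v) + H v)
    (hHE : ∀ v, H (E v) = E (H v) + (2 : k) • E v)
    (hHF : ∀ v, H (F v) = F (H v) - (2 : k) • F v)
    {W : Submodule k V} (hEW : ∀ v ∈ W, E v ∈ W) (hFW : ∀ v ∈ W, F v ∈ W)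
    {x : V} (hx : H x = 0) (hxW : E x ∈ W) :
    ∃ b ∈ W, E (x + b) = 0 ∧ F (x + b) = 0 := by
  suffices hEx : ∃ b ∈ W, H (x + b) = 0 ∧ E (x + b) = 0 by
    obtain ⟨b, hb, hH0, hE0⟩ := hEx
    refine ⟨b, hb, hE0, ?_⟩
    by_contra hne
    obtain ⟨n, hn, hn'⟩ := exists_pow_apply_ne_zero_of_locally_nilpotent hne (hF _)
    have hwt : (-H) (F (x + b)) = (2 : k) • F (x + b) := by
      rw [LinearMap.neg_apply, hHF, hH0, map_zero, zero_sub, neg_neg]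
    have := pow_succ_apply_of_weight (E := F) (F := E) (H := -H)
      (fun v => by rw [hEF, LinearMap.neg_apply]; abel)
      (fun v => by rw [LinearMap.neg_apply, hHF, LinearMap.neg_apply, map_neg]; abel) hwt n
    rw [hEF, hE0, hH0, map_zero, add_zero, map_zero, hn' _ n.lt_succ_self, map_zero, zero_add,
      eq_comm, smul_eq_zero] at this
    refine this.elim (fun h => ?_) hn
    have h' : ((n + 1) * (2 + n) : ℕ) = 0 := by exact_mod_cast h
    simp at h'
  obtain ⟨N, hN⟩ := hE x
  have hN' : (E ^ (N + 1)) x = 0 := by rw [pow_succ', Module.End.mul_apply, hN, map_zero]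
  clear hN
  induction N generalizing x with
  | zero => exact ⟨0, W.zero_mem, by simpa using hx, by simpa using hN'⟩
  | succ N ih =>
    set c : k := (N + 1) * (2 + N) with hc
    have hc0 : c ≠ 0 := by
      have : ((N + 1) * (2 + N) : ℕ) ≠ 0 := by positivity
      rw [hc]
      exact_mod_cast this
    have hHEx : H (E x) = (2 : k) • E x := by rw [hHE, hx, map_zero, zero_add]
    have hstep := pow_succ_apply_of_weight hEF hHE hHEx N
    rw [← Module.End.mul_apply (E ^ (N + 1)) E, ← pow_succ, hN', map_zero, zero_add,
      ← Module.End.mul_apply (E ^ N) E, ← pow_succ, ← hc] at hstep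
    have hbW : -(c⁻¹ • F (E x)) ∈ W := W.neg_mem (W.smul_mem _ (hFW _ hxW))
    refine (ih (x := x + -(c⁻¹ • F (E x))) ?_ ?_ ?_).imp' (-(c⁻¹ • F (E x)) + ·) ?_
    · rw [map_add, hx, map_neg, map_smul, hHF, hHEx, map_smul, sub_self, smul_zero, neg_zero,
        add_zero]
    · rw [map_add]
      exact W.add_mem hxW (hEW _ hbW)
    · rw [map_add, map_neg, map_smul, hstep, inv_smul_smul₀ hc0, add_neg_cancel]
    · rintro b ⟨hb, hb'⟩
      exact ⟨W.add_mem hbW hb, by simpa only [add_assoc] using hb'⟩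

/-- every extension of a fundamental pair `(D,U)` on an affine `k`-domain
`B` to a fundamental pair `(D',U')` of `B[t]` is trivial: there is `s ∈ B[t]` with
`B[t] = B[s]` and `D's = U's = 0`. -/
theorem stmt_14 {k B : Type*} [Field k] [CharZero k] [CommRing B] [IsDomain B] [Algebra k B]
    [Algebra.FiniteType k B]
    (D U : Derivation k B B) (hDU : IsFundamentalPair D U)
    (D' U' : Derivation k (Polynomial B) (Polynomial B))
    (hD' : ∀ b : B, D' (Polynomial.C b) = Polynomial.C (D b))
    (hU' : ∀ b : B, U' (Polynomial.C b) = Polynomial.C (U b))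
    (hDU' : IsFundamentalPair D' U') :
    ∃ s : Polynomial B, Algebra.adjoin B {s} = ⊤ ∧ D' s = 0 ∧ U' s = 0 := by
  have : CharZero B := charZero_of_injective_algebraMap (algebraMap k B).injective
  obtain ⟨hD, hU, -, -, hspan⟩ := hDU
  obtain ⟨hLD', hLU', hDH, hUH, hspan'⟩ := hDU'
  obtain ⟨β, hβ⟩ := hD.exists_apply_X_eq_C hLD' hD'
  obtain ⟨γ, hγ⟩ := hU.exists_apply_X_eq_C hLU' hU'
  set H : Derivation k B B := ⁅D, U⁆ with hH
  set H' : Derivation k B[X] B[X] := ⁅D', U'⁆ with hH'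
  have hHC (b : B) : H' (C b) = C (H b) := by
    simp [hH, hH', Derivation.commutator_apply, hD', hU']
  obtain ⟨η, hη⟩ : ∃ η, H' X = C η :=
    ⟨D γ - U β, by simp [hH', Derivation.commutator_apply, hβ, hγ, hD', hU']⟩
  obtain ⟨y, hy⟩ := exists_apply_sub_apply_eq_zero hspan η
  have hx : H' (X - C y) = 0 := by
    refine apply_eq_zero_of_apply_apply_eq_zero (H := H'.toLinearMap) hspan' ?_
    have : H' (X - C y) = C (η - H y) := by rw [map_sub, hη, hHC, C_sub]
    simp only [Derivation.coeFn_coe] at hy ⊢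
    rw [this, hHC, hy, C_0]
  obtain ⟨b, ⟨c, rfl⟩, hDb, hUb⟩ := exists_mem_add_invariant (k := k) (E := D'.toLinearMap)
    (F := U'.toLinearMap) (H := H'.toLinearMap)
    (W := LinearMap.range (CAlgHom (R := k) (A := B)).toLinearMap) (x := X - C y)
    hLD' hLU'
    (fun v => by simp only [hH', Derivation.coeFn_coe, Derivation.commutator_apply]; abel)
    (fun v => by
      have := congrArg (fun d => d v) hDH
      simp only [Derivation.commutator_apply, Derivation.smul_apply] at this
      rw [← Int.cast_smul_eq_zsmul k] at this
      push_cast at this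
      rw [neg_smul] at this
      simp only [Derivation.coeFn_coe]
      linear_combination -this)
    (fun v => by
      have := congrArg (fun d => d v) hUH
      simp only [Derivation.commutator_apply, Derivation.smul_apply] at this
      rw [← Int.cast_smul_eq_zsmul k] at this
      push_cast at this
      simp only [Derivation.coeFn_coe]
      linear_combination -this)
    (by rintro _ ⟨b, rfl⟩; exact ⟨D b, (hD' b).symm⟩)
    (by rintro _ ⟨b, rfl⟩; exact ⟨U b, (hU' b).symm⟩)
    hx ⟨β - D y, by simp [hβ, hD']⟩
  refine ⟨X - C y + C c, ?_, hDb, hUb⟩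
  have hX : (X : B[X]) ∈ Algebra.adjoin B {X - C y + C c} := by
    have h1 : (X : B[X]) = (X - C y + C c) + algebraMap B B[X] (y - c) := by
      rw [algebraMap_eq, C_sub]
      ring
    have := add_mem (Algebra.self_mem_adjoin_singleton B (X - C y + C c))
      (Subalgebra.algebraMap_mem _ (y - c))
    rwa [← h1] at this
  rw [eq_top_iff, ← adjoin_X]
  exact Algebra.adjoin_le (by simpa using hX)
end

section
/- Let R be an affine UFD over k and B = R[X,Y] ≅ R^[2]. Then every nontrivial fundamental pair (D,U) of locally nilpotent R-derivations of B is conjugate by an R-algebra automorphism of B to the fundamental pair (X∂_Y, Y∂_X); equivalently, there exist P, Q ∈ B with B = R[P,Q] and DP = 0, DQ = P, UQ = 0, UP = Q. -/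
open MvPolynomial

section LND

variable {R B : Type*} [CommRing R] [CommRing B] [Algebra R B]

lemma isLND_iff (D : Derivation R B B) : IsLND D ↔ ∀ b : B, ∃ n : ℕ, D^[n] b = 0 := by
  simp only [IsLND, Module.End.pow_apply]
  rfl

lemma IsLND.exists_last {D : Derivation R B B} (hD : IsLND D) {f : B} (hf : f ≠ 0) :
    ∃ m : ℕ, D^[m] f ≠ 0 ∧ D^[m + 1] f = 0 := by
  classical
  have h := (isLND_iff D).1 hD f
  have h0 : Nat.find h ≠ 0 := fun h0 => hf (by simpa [h0] using Nat.find_spec h)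
  obtain ⟨m, hm⟩ := Nat.exists_eq_succ_of_ne_zero h0
  exact ⟨m, Nat.find_min h (by omega), by simpa [hm] using Nat.find_spec h⟩

lemma exists_iterate_mul_eq (D : Derivation R B B) (n : ℕ) : ∀ m l : ℕ, m + l = n →
    ∃ c : ℕ, c ≠ 0 ∧ ∀ f g : B, D^[m + 1] f = 0 → D^[l + 1] g = 0 →
      D^[n] (f * g) = c * (D^[m] f * D^[l] g) := by
  induction n with
  | zero =>
    intro m l h
    obtain ⟨rfl, rfl⟩ : m = 0 ∧ l = 0 := by omega
    exact ⟨1, one_ne_zero, fun f g _ _ => by simp⟩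
  | succ n ih =>
    have key : ∀ f g : B, D^[n + 1] (f * g) = D^[n] (f * D g) + D^[n] (D f * g) := by
      intro f g
      rw [Function.iterate_succ_apply, D.leibniz, smul_eq_mul, smul_eq_mul,
        iterate_map_add, mul_comm g]
    intro m l h
    rcases m with _ | m
    · obtain rfl : l = n + 1 := by omega
      obtain ⟨c, hc, H⟩ := ih 0 n (by omega)
      refine ⟨c, hc, fun f g hf hg => ?_⟩
      rw [key, H f (D g) hf hg, show D f = 0 from hf, zero_mul, iterate_map_zero, add_zero]
      simp
    · rcases l with _ | l
      · obtain rfl : m = n := by omega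
        obtain ⟨c, hc, H⟩ := ih m 0 (by omega)
        refine ⟨c, hc, fun f g hf hg => ?_⟩
        rw [key, H (D f) g hf hg, show D g = 0 from hg, mul_zero, iterate_map_zero, zero_add]
        simp
      · obtain ⟨c, hc, H⟩ := ih m (l + 1) (by omega)
        obtain ⟨c', hc', H'⟩ := ih (m + 1) l (by omega)
        refine ⟨c' + c, by omega, fun f g hf hg => ?_⟩
        rw [key, H (D f) g hf hg, H' f (D g) hf hg]
        simp only [Function.iterate_succ_apply]
        push_cast
        ring

lemma iterate_eq_zero_of_le (D : Derivation R B B) {m n : ℕ} (h : m ≤ n) {f : B}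
    (hf : D^[m] f = 0) : D^[n] f = 0 := by
  obtain ⟨k, rfl⟩ := Nat.exists_eq_add_of_le' h
  rw [Function.iterate_add_apply, hf, iterate_map_zero]

variable [IsDomain B] [CharZero B]

lemma iterate_mul_ne_zero (D : Derivation R B B) {m l : ℕ} {f g : B}
    (hf : D^[m + 1] f = 0) (hg : D^[l + 1] g = 0) (hf0 : D^[m] f ≠ 0) (hg0 : D^[l] g ≠ 0) :
    D^[m + l] (f * g) ≠ 0 := by
  obtain ⟨c, hc, H⟩ := exists_iterate_mul_eq D (m + l) m l rfl
  rw [H f g hf hg]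
  exact mul_ne_zero (Nat.cast_ne_zero.2 hc) (mul_ne_zero hf0 hg0)

lemma IsLND.exists_of_iterate_mul_eq_zero {D : Derivation R B B} (hD : IsLND D) {f g : B}
    (hfg : f * g ≠ 0) {n : ℕ} (h : D^[n + 1] (f * g) = 0) :
    ∃ m l : ℕ, m + l ≤ n ∧ D^[m] f ≠ 0 ∧ D^[m + 1] f = 0 ∧ D^[l + 1] g = 0 := by
  obtain ⟨m, hm, hm'⟩ := hD.exists_last (left_ne_zero_of_mul hfg)
  obtain ⟨l, hl, hl'⟩ := hD.exists_last (right_ne_zero_of_mul hfg)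
  refine ⟨m, l, ?_, hm, hm', hl'⟩
  by_contra! hlt
  exact iterate_mul_ne_zero D hm' hl' hm hl (iterate_eq_zero_of_le D hlt h)

lemma IsLND.eq_zero_of_mul {D : Derivation R B B} (hD : IsLND D) {f g : B}
    (hfg : f * g ≠ 0) (h : D (f * g) = 0) : D f = 0 := by
  obtain ⟨m, l, hml, -, hm, -⟩ := hD.exists_of_iterate_mul_eq_zero hfg (n := 0) h
  obtain rfl : m = 0 := by omega
  exact hm

lemma IsLND.eq_zero_of_apply_eq_mul_s15 {D : Derivation R B B} (hD : IsLND D) {f g : B}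
    (hf : f ≠ 0) (h : D f = g * f) : g = 0 := by
  by_contra hg
  obtain ⟨m, hm, hm'⟩ := hD.exists_last hf
  obtain ⟨l, hl, hl'⟩ := hD.exists_last hg
  refine iterate_mul_ne_zero D hl' hm' hl hm ?_
  rw [← h, ← Function.iterate_succ_apply]
  exact iterate_eq_zero_of_le D (by omega) hm'

end LND

section Plane

variable {R : Type*} [CommRing R]

lemma derivation_apply_eq (V : Derivation R (MvPolynomial (Fin 2) R) (MvPolynomial (Fin 2) R))
    (f : MvPolynomial (Fin 2) R) :
    V f = pderiv 0 f * V (X 0) + pderiv 1 f * V (X 1) := by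
  have : V = V (X 0) • (pderiv 0 : Derivation R (MvPolynomial (Fin 2) R) (MvPolynomial (Fin 2) R)) +
      V (X 1) • (pderiv 1 : Derivation R (MvPolynomial (Fin 2) R) (MvPolynomial (Fin 2) R)) := by
    refine derivation_ext fun i => ?_
    fin_cases i <;> simp
  conv_lhs => rw [this]
  simp [mul_comm]

lemma pderiv_pderiv_comm (f : MvPolynomial (Fin 2) R) :
    pderiv (0 : Fin 2) (pderiv (1 : Fin 2) f) = pderiv 1 (pderiv 0 f) := by
  have : ⁅(pderiv 0 : Derivation R (MvPolynomial (Fin 2) R) (MvPolynomial (Fin 2) R)),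
    (pderiv 1 : Derivation R (MvPolynomial (Fin 2) R) (MvPolynomial (Fin 2) R))⁆ = 0 := by
    refine derivation_ext fun i => ?_
    fin_cases i <;> simp [Derivation.commutator_apply]
  rw [← sub_eq_zero, ← Derivation.commutator_apply, this, Derivation.zero_apply]

/-- The Jacobian determinant of two polynomials in two variables. -/
noncomputable def jacobian (f g : MvPolynomial (Fin 2) R) : MvPolynomial (Fin 2) R :=
  pderiv 0 f * pderiv 1 g - pderiv 1 f * pderiv 0 g

/-- The divergence of a derivation of the polynomial ring in two variables. -/
noncomputable def divergence (V : Derivation R (MvPolynomial (Fin 2) R) (MvPolynomial (Fin 2) R)) :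
    MvPolynomial (Fin 2) R :=
  pderiv 0 (V (X 0)) + pderiv 1 (V (X 1))

/-- The standard area form evaluated on two derivations. -/
noncomputable def area (V W : Derivation R (MvPolynomial (Fin 2) R) (MvPolynomial (Fin 2) R)) :
    MvPolynomial (Fin 2) R :=
  V (X 0) * W (X 1) - V (X 1) * W (X 0)

lemma derivation_jacobian_add (V : Derivation R (MvPolynomial (Fin 2) R) (MvPolynomial (Fin 2) R))
    (f g : MvPolynomial (Fin 2) R) :
    V (jacobian f g) + divergence V * jacobian f g = jacobian (V f) g + jacobian f (V g) := by
  simp only [derivation_apply_eq V f, derivation_apply_eq V g, jacobian, divergence, map_add,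
    map_sub, Derivation.leibniz, smul_eq_mul, pderiv_pderiv_comm,
    derivation_apply_eq V (pderiv _ _)]
  ring

lemma area_add_area (V A W : Derivation R (MvPolynomial (Fin 2) R) (MvPolynomial (Fin 2) R)) :
    area ⁅V, A⁆ W + area A ⁅V, W⁆ = V (area A W) - divergence V * area A W := by
  simp only [area, divergence, Derivation.commutator_apply, map_sub, Derivation.leibniz,
    smul_eq_mul]
  simp only [derivation_apply_eq A (V _), derivation_apply_eq W (V _)]
  ring

lemma commutator_eq_jacobian {V W : Derivation R (MvPolynomial (Fin 2) R) (MvPolynomial (Fin 2) R)}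
    (hV : divergence V = 0)
    (hW : divergence W = 0) (f : MvPolynomial (Fin 2) R) : ⁅V, W⁆ f = jacobian (area V W) f := by
  have hV' := eq_neg_of_add_eq_zero_left hV
  have hW' := eq_neg_of_add_eq_zero_left hW
  rw [derivation_apply_eq]
  simp only [Derivation.commutator_apply, jacobian, area, map_sub, Derivation.leibniz,
    smul_eq_mul]
  rw [derivation_apply_eq V (W _), derivation_apply_eq V (W _), derivation_apply_eq W (V _),
    derivation_apply_eq W (V _), hV', hW']
  ring

lemma divergence_eq_zero [IsDomain R] [CharZero R]
    {D : Derivation R (MvPolynomial (Fin 2) R) (MvPolynomial (Fin 2) R)} (hD : IsLND D) :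
    divergence D = 0 := by
  classical
  let T : MvPolynomial (Fin 2) R →ₗ[R] MvPolynomial (Fin 2) R :=
    D.toLinearMap + LinearMap.mulLeft R (divergence D)
  have hT : ∀ f, T f = D f + divergence D * f := fun f => rfl
  have hnil : ∀ n i j : ℕ, i + j ≤ n → ∀ f g : MvPolynomial (Fin 2) R, D^[i] f = 0 → D^[j] g = 0 →
      T^[n] (jacobian f g) = 0 := by
    intro n
    induction n with
    | zero =>
      intro i j hij f g hf _
      obtain rfl : i = 0 := by omega
      simp [jacobian, show f = 0 from hf]
    | succ n ih =>
      intro i j hij f g hf hg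
      rcases i with _ | i
      · rw [show f = 0 from hf]
        simp [jacobian]
      · rcases j with _ | j
        · rw [show g = 0 from hg]
          simp [jacobian]
        · rw [Function.iterate_succ_apply, hT, derivation_jacobian_add, iterate_map_add,
            ih i (j + 1) (by omega) (D f) g hf hg, ih (i + 1) j (by omega) f (D g) hf hg,
            add_zero]
  have hex : ∃ n, T^[n] 1 = 0 := by
    obtain ⟨i, hi⟩ := (isLND_iff D).1 hD (X 0)
    obtain ⟨j, hj⟩ := (isLND_iff D).1 hD (X 1)
    refine ⟨i + j, ?_⟩
    have := hnil (i + j) i j le_rfl _ _ hi hj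
    simpa [jacobian] using this
  have h0 : Nat.find hex ≠ 0 := fun h0 => by simpa [h0] using Nat.find_spec hex
  obtain ⟨m, hm⟩ := Nat.exists_eq_succ_of_ne_zero h0
  have hne : T^[m] 1 ≠ 0 := Nat.find_min hex (by omega)
  have hz : T (T^[m] 1) = 0 := by
    rw [← Function.iterate_succ_apply' T, ← hm]
    exact Nat.find_spec hex
  rw [hT] at hz
  have := hD.eq_zero_of_apply_eq_mul_s15 hne (g := -divergence D) (by linear_combination hz)
  simpa using this

lemma area_mul_sub_area_mul
    (V W Z : Derivation R (MvPolynomial (Fin 2) R) (MvPolynomial (Fin 2) R))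
    (f : MvPolynomial (Fin 2) R) : area V W * Z f = area Z W * V f + area V Z * W f := by
  rw [derivation_apply_eq V, derivation_apply_eq W, derivation_apply_eq Z]
  simp only [area]
  ring

lemma exists_eq_C_of_pderiv_eq_zero [IsDomain R] [CharZero R] {f : MvPolynomial (Fin 2) R}
    (h : ∀ i, pderiv i f = 0) : ∃ a, f = C a := by
  refine ⟨coeff 0 f, ?_⟩
  ext m
  rw [coeff_C]
  split_ifs with hm
  · rw [hm]
  · obtain ⟨i, hi⟩ : ∃ i, m i ≠ 0 := by
      by_contra! hcon
      exact hm (Finsupp.ext hcon).symm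
    have h1 := coeff_pderiv (i := i) f (m - Finsupp.single i 1)
    rw [h i, coeff_zero, tsub_add_cancel_of_le (by simpa using Nat.one_le_iff_ne_zero.2 hi)] at h1
    rcases mul_eq_zero.1 h1.symm with h2 | h2
    · exact h2
    · exact absurd h2 (by norm_cast)

end Plane

/-- The extension of a derivation of a polynomial ring along a change of coefficients. -/
noncomputable def baseChange {R : Type*} [CommRing R] (L : Type*) [CommRing L] [Algebra R L]
    (D : Derivation R (MvPolynomial (Fin 2) R) (MvPolynomial (Fin 2) R)) :
    Derivation L (MvPolynomial (Fin 2) L) (MvPolynomial (Fin 2) L) :=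
  mkDerivation L fun i => map (algebraMap R L) (D (X i))

section BaseChange

variable {S L : Type*} [CommRing S] [CommRing L] [Algebra S L]
  (D U : Derivation S (MvPolynomial (Fin 2) S) (MvPolynomial (Fin 2) S))

lemma baseChange_map (f : MvPolynomial (Fin 2) S) :
    baseChange L D (map (algebraMap S L) f) = map (algebraMap S L) (D f) := by
  rw [derivation_apply_eq, derivation_apply_eq D f]
  simp [baseChange, pderiv_map]

lemma lie_baseChange : ⁅baseChange L D, baseChange L U⁆ = baseChange L ⁅D, U⁆ := by
  refine derivation_ext fun i => ?_
  rw [Derivation.commutator_apply, ← map_X (algebraMap S L) i]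
  simp only [baseChange_map]
  rw [Derivation.commutator_apply, map_sub]

lemma zsmul_baseChange (n : ℤ) : n • baseChange L D = baseChange L (n • D) := by
  refine derivation_ext fun i => ?_
  rw [Derivation.smul_apply, ← map_X (algebraMap S L) i]
  simp only [baseChange_map]
  rw [Derivation.smul_apply, map_zsmul]

lemma area_baseChange :
    area (baseChange L D) (baseChange L U) = map (algebraMap S L) (area D U) := by
  simp only [area, ← map_X (algebraMap S L), baseChange_map]
  simp

lemma isLND_baseChange {D : Derivation S (MvPolynomial (Fin 2) S) (MvPolynomial (Fin 2) S)}
    (hD : IsLND D) : IsLND (baseChange L D) := by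
  rw [isLND_iff] at hD ⊢
  have hmap : ∀ (n : ℕ) (f : MvPolynomial (Fin 2) S),
      (baseChange L D)^[n] (map (algebraMap S L) f) = map (algebraMap S L) (D^[n] f) := by
    intro n
    induction n with
    | zero => simp
    | succ n ih =>
      intro f
      rw [Function.iterate_succ_apply, baseChange_map, ih, Function.iterate_succ_apply]
  intro f
  induction f using MvPolynomial.monomial_add_induction_on with
  | C a => exact ⟨1, derivation_C _ a⟩
  | monomial_add m a f _ _ ih =>
    obtain ⟨k, hk⟩ := ih
    obtain ⟨n, hn⟩ := hD (monomial m 1)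
    have hmon : (baseChange L D)^[n] (monomial m a) = 0 := by
      have : (monomial m a : MvPolynomial (Fin 2) L) =
          a • map (algebraMap S L) (monomial m 1) := by
        simp [smul_monomial]
      rw [this]
      have := ((baseChange L D).toLinearMap ^ n).map_smul a
        (map (algebraMap S L) (monomial m 1))
      rw [Module.End.pow_apply, Module.End.pow_apply] at this
      refine this.trans ?_
      exact (congrArg (a • ·) ((hmap n _).trans (by rw [hn, map_zero]))).trans (smul_zero a)
    refine ⟨n + k, ?_⟩
    rw [iterate_map_add, iterate_eq_zero_of_le _ (Nat.le_add_right n k) hmon,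
      iterate_eq_zero_of_le _ (Nat.le_add_left k n) hk, add_zero]

end BaseChange

section UFD

lemma exists_eq_mul_sq_of_mul_eq_sq {A : Type*} [CommRing A] [IsDomain A]
    [UniqueFactorizationMonoid A] (M : Submonoid A) (hM : ∀ u : A, IsUnit u → u ∈ M) (p : A) :
    ∀ s q : A, p ≠ 0 → p * s = q ^ 2 → (∀ π : A, Prime π → π ∣ p → π ∣ s → π ∈ M) →
      ∃ r ∈ M, ∃ f, p = r * f ^ 2 := by
  induction p using (wellFounded_dvdNotUnit (α := A)).induction with
  | _ p ih =>
  intro s q hp hps hprime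
  by_cases hu : IsUnit p
  · exact ⟨p, hM p hu, 1, by simp⟩
  obtain ⟨π, hirr, p', rfl⟩ := WfDvdMonoid.exists_irreducible_factor hu hp
  have hπ := hirr.prime
  obtain ⟨q', rfl⟩ : π ∣ q := hπ.dvd_of_dvd_pow (n := 2) ⟨p' * s, by rw [← hps, mul_assoc]⟩
  have hp' : p' ≠ 0 := right_ne_zero_of_mul hp
  have hq' : p' * s = π * q' ^ 2 :=
    mul_left_cancel₀ hπ.ne_zero (by linear_combination hps)
  rcases hπ.dvd_or_dvd (Dvd.intro _ hq'.symm) with ⟨p'', rfl⟩ | ⟨s', rfl⟩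
  · obtain ⟨r, hr, f, rfl⟩ := ih p'' ⟨right_ne_zero_of_mul hp', π * π,
        fun h => hπ.not_isUnit (isUnit_of_mul_isUnit_left h), by ring⟩ s q'
      (right_ne_zero_of_mul hp') (mul_left_cancel₀ hπ.ne_zero (by linear_combination hq'))
      (fun ρ hρ h1 h2 => hprime ρ hρ ((h1.mul_left π).mul_left π) h2)
    exact ⟨r, hr, π * f, by ring⟩
  · obtain ⟨r, hr, f, rfl⟩ := ih p' ⟨hp', π, hπ.not_isUnit, by ring⟩ s' q'
      hp' (mul_left_cancel₀ hπ.ne_zero (by linear_combination hq'))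
      (fun ρ hρ h1 h2 => hprime ρ hρ (h1.mul_left π) (h2.mul_left π))
    exact ⟨π * r, M.mul_mem (hprime π hπ (Dvd.intro _ rfl) (Dvd.intro _ rfl)) hr, f, by ring⟩

lemma exists_eq_C_mul_of_forall_prime_not_dvd {σ S : Type*} [Finite σ] [CommRing S] [IsDomain S]
    [UniqueFactorizationMonoid S] (f : MvPolynomial σ S) (hf : f ≠ 0) :
    ∃ (a : S) (P : MvPolynomial σ S), f = C a * P ∧ ∀ b : S, Prime b → ¬ C b ∣ P := by
  induction f using (wellFounded_dvdNotUnit (α := MvPolynomial σ S)).induction with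
  | _ f ih =>
  by_cases h : ∃ b : S, Prime b ∧ C b ∣ f
  · obtain ⟨b, hb, g, rfl⟩ := h
    have hg := right_ne_zero_of_mul hf
    obtain ⟨a, P, rfl, hP⟩ :=
      ih g ⟨hg, C b, ((prime_C_iff σ).2 hb).not_isUnit, mul_comm _ _⟩ hg
    exact ⟨b * a, P, by rw [C_mul, mul_assoc], hP⟩
  · exact ⟨1, f, by simp, fun b hb hd => h ⟨b, hb, hd⟩⟩

end UFD

/-- Two locally nilpotent derivations satisfying the relations of the standard
generators of `sl₂`. -/
structure IsSl2Pair {R B : Type*} [CommRing R] [CommRing B] [Algebra R B]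
    (D U : Derivation R B B) : Prop where
  isLND_left : IsLND D
  isLND_right : IsLND U
  lie_left : ⁅D, ⁅D, U⁆⁆ = (-2 : ℤ) • D
  lie_right : ⁅U, ⁅D, U⁆⁆ = (2 : ℤ) • U

namespace IsSl2Pair

section General

variable {R B : Type*} [CommRing R] [CommRing B] [Algebra R B] {D U : Derivation R B B}

lemma left_weight (h : IsSl2Pair D U) (f : B) : D (⁅D, U⁆ f) = ⁅D, U⁆ (D f) - 2 * D f := by
  have := congrArg (fun V : Derivation R B B => V f) h.lie_left
  rw [Derivation.commutator_apply] at this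
  simp only [Derivation.smul_apply, zsmul_eq_mul] at this
  push_cast at this
  linear_combination this

lemma right_weight (h : IsSl2Pair D U) (f : B) : U (⁅D, U⁆ f) = ⁅D, U⁆ (U f) + 2 * U f := by
  have := congrArg (fun V : Derivation R B B => V f) h.lie_right
  rw [Derivation.commutator_apply] at this
  simp only [Derivation.smul_apply, zsmul_eq_mul] at this
  push_cast at this
  linear_combination this

lemma left_right (D U : Derivation R B B) (f : B) : D (U f) = U (D f) + ⁅D, U⁆ f := by
  rw [Derivation.commutator_apply]
  ring

lemma lie_iterate_right (h : IsSl2Pair D U) {d : ℤ} {x : B} (hx : ⁅D, U⁆ x = d • x) (n : ℕ) :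
    ⁅D, U⁆ (U^[n] x) = (d - 2 * n) • U^[n] x := by
  induction n with
  | zero => simpa using hx
  | succ n ih =>
    have := h.right_weight (U^[n] x)
    rw [ih, map_zsmul] at this
    rw [Function.iterate_succ_apply']
    simp only [zsmul_eq_mul] at this ⊢
    push_cast at this ⊢
    linear_combination -this

lemma left_iterate_right (h : IsSl2Pair D U) {d : ℤ} {x : B} (hx : ⁅D, U⁆ x = d • x) (n : ℕ) :
    D (U^[n + 1] x) = U^[n + 1] (D x) + ((n + 1) * (d - n)) • U^[n] x := by
  induction n with
  | zero => simp [left_right D U x, hx]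
  | succ n ih =>
    rw [Function.iterate_succ_apply', left_right, ih, h.lie_iterate_right hx, map_add, map_zsmul,
      ← Function.iterate_succ_apply' U, ← Function.iterate_succ_apply' U, add_assoc, ← add_smul]
    congr 2
    push_cast
    ring

lemma mem_of_weight_neg [Algebra ℚ R] (h : IsSl2Pair D U) {N : ℤ → Submodule R B}
    (hND : ∀ d, ∀ x ∈ N d, D x ∈ N (d + 2)) (hNU : ∀ d, ∀ x ∈ N d, U x ∈ N (d - 2))
    {d : ℤ} (hd : d < 0) {x : B} (hx : ⁅D, U⁆ x = d • x) (hDx : D x ∈ N (d + 2)) : x ∈ N d := by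
  have hiter : ∀ n : ℕ, U^[n] (D x) ∈ N (d + 2 - 2 * n) := by
    intro n
    induction n with
    | zero => simpa using hDx
    | succ n ih =>
      rw [Function.iterate_succ_apply']
      convert hNU _ _ ih using 2
      push_cast
      ring
  have hdiv : ∀ (e m : ℤ) (y : B), m ≠ 0 → m • y ∈ N e → y ∈ N e := by
    intro e m y hm hy
    have := (N e).smul_mem (algebraMap ℚ R (m : ℚ)⁻¹) hy
    rwa [← Int.cast_smul_eq_zsmul R m y, smul_smul, ← map_intCast (algebraMap ℚ R) m, ← map_mul,
      inv_mul_cancel₀ (Int.cast_ne_zero.2 hm), map_one, one_smul] at this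
  have hdown : ∀ n : ℕ, U^[n] x ∈ N (d - 2 * n) → x ∈ N d := by
    intro n
    induction n with
    | zero => simp
    | succ n ih =>
      intro hn
      refine ih (hdiv _ ((n + 1) * (d - n)) _ (mul_ne_zero (by omega) (by omega)) ?_)
      have h1 := hND _ _ hn
      rw [h.left_iterate_right hx] at h1
      have h2 := hiter (n + 1)
      rw [show d - 2 * ((n + 1 : ℕ) : ℤ) + 2 = d - 2 * n by push_cast; ring] at h1
      rw [show d + 2 - 2 * ((n + 1 : ℕ) : ℤ) = d - 2 * n by push_cast; ring] at h2
      exact ((N _).add_mem_iff_right h2).1 h1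
  obtain ⟨n, hn⟩ := (isLND_iff U).1 h.isLND_right x
  exact hdown n (hn ▸ Submodule.zero_mem _)

lemma isSl2Pair_baseChange {S : Type*} [CommRing S]
    {D U : Derivation S (MvPolynomial (Fin 2) S) (MvPolynomial (Fin 2) S)} (h : IsSl2Pair D U)
    (L : Type*) [CommRing L] [Algebra S L] :
    IsSl2Pair (baseChange L D) (baseChange L U) where
  isLND_left := isLND_baseChange h.isLND_left
  isLND_right := isLND_baseChange h.isLND_right
  lie_left := by rw [lie_baseChange, lie_baseChange, h.lie_left, zsmul_baseChange]
  lie_right := by rw [lie_baseChange, lie_baseChange, h.lie_right, zsmul_baseChange]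

end General

variable {R : Type*} [CommRing R] [IsDomain R] [CharZero R]

variable {D U : Derivation R (MvPolynomial (Fin 2) R) (MvPolynomial (Fin 2) R)}

lemma divergence_lie (h : IsSl2Pair D U) : divergence ⁅D, U⁆ = 0 := by
  have hD := divergence_eq_zero h.isLND_left
  have hU := divergence_eq_zero h.isLND_right
  rw [divergence, commutator_eq_jacobian hD hU, commutator_eq_jacobian hD hU]
  simp [jacobian, pderiv_pderiv_comm]

lemma left_area_lie_left (h : IsSl2Pair D U) : D (area ⁅D, U⁆ D) = 0 := by
  have := area_add_area D ⁅D, U⁆ D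
  rw [divergence_eq_zero h.isLND_left, h.lie_left, lie_self] at this
  simp only [area, Derivation.smul_apply, Derivation.zero_apply, zsmul_eq_mul] at this ⊢
  linear_combination -this

lemma right_area_lie_left (h : IsSl2Pair D U) : U (area ⁅D, U⁆ D) = -2 * area D U := by
  have := area_add_area U ⁅D, U⁆ D
  rw [divergence_eq_zero h.isLND_right, h.lie_right, ← lie_skew U D] at this
  simp only [area, Derivation.smul_apply, Derivation.neg_apply, zsmul_eq_mul] at this ⊢
  push_cast at this
  linear_combination -this

lemma left_area (h : IsSl2Pair D U) : D (area D U) = -area ⁅D, U⁆ D := by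
  have := area_add_area D D U
  rw [divergence_eq_zero h.isLND_left, lie_self] at this
  simp only [area, Derivation.zero_apply] at this ⊢
  linear_combination -this

lemma right_area (h : IsSl2Pair D U) : U (area D U) = -area ⁅D, U⁆ U := by
  have := area_add_area U D U
  rw [divergence_eq_zero h.isLND_right, lie_self, ← lie_skew U D] at this
  simp only [area, Derivation.zero_apply, Derivation.neg_apply] at this ⊢
  linear_combination -this

lemma left_area_lie_right (h : IsSl2Pair D U) : D (area ⁅D, U⁆ U) = -2 * area D U := by
  have := area_add_area D ⁅D, U⁆ U
  rw [divergence_eq_zero h.isLND_left, h.lie_left] at this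
  simp only [area, Derivation.smul_apply, zsmul_eq_mul] at this ⊢
  push_cast at this
  linear_combination -this

lemma right_area_lie_right (h : IsSl2Pair D U) : U (area ⁅D, U⁆ U) = 0 := by
  have := area_add_area U ⁅D, U⁆ U
  rw [divergence_eq_zero h.isLND_right, h.lie_right, lie_self] at this
  simp only [area, Derivation.smul_apply, Derivation.zero_apply, zsmul_eq_mul] at this ⊢
  linear_combination -this

lemma lie_area (h : IsSl2Pair D U) : ⁅D, U⁆ (area D U) = 0 := by
  rw [Derivation.commutator_apply, h.right_area, h.left_area, map_neg, map_neg,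
    h.left_area_lie_right, h.right_area_lie_left]
  ring

lemma lie_area_lie_left (h : IsSl2Pair D U) :
    ⁅D, U⁆ (area ⁅D, U⁆ D) = 2 * area ⁅D, U⁆ D := by
  rw [Derivation.commutator_apply, h.right_area_lie_left, h.left_area_lie_left,
    show (-2 : MvPolynomial (Fin 2) R) * area D U =
      (-2 : ℤ) • area D U by simp, map_zsmul, h.left_area]
  simp

lemma area_lie_left_ne_zero (h : IsSl2Pair D U) (hnt : ¬(D = 0 ∧ U = 0)) :
    area ⁅D, U⁆ D ≠ 0 := by
  intro h0
  have hD : D = 0 := by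
    ext1 i
    have := commutator_eq_jacobian h.divergence_lie (divergence_eq_zero h.isLND_left) (X i)
    rw [h0, Derivation.commutator_apply, h.left_weight] at this
    simpa [jacobian] using this
  refine hnt ⟨hD, ?_⟩
  ext1 i
  have := h.right_weight (X i)
  simpa [hD, Derivation.commutator_apply] using this

lemma exists_eq_C_of_left_eq_zero (h : IsSl2Pair D U) (hnt : ¬(D = 0 ∧ U = 0))
    {f : MvPolynomial (Fin 2) R}
    (hD : D f = 0) (hH : ⁅D, U⁆ f = 0) : ∃ a, f = C a := by
  refine exists_eq_C_of_pderiv_eq_zero fun i => ?_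
  have := area_mul_sub_area_mul ⁅D, U⁆ D (pderiv i) f
  rw [hD, hH] at this
  simpa [h.area_lie_left_ne_zero hnt] using this

lemma exists_eq_C (h : IsSl2Pair D U) (hnt : ¬(D = 0 ∧ U = 0)) {f : MvPolynomial (Fin 2) R}
    (hD : D f = 0) (hU : U f = 0) : ∃ a, f = C a :=
  h.exists_eq_C_of_left_eq_zero hnt hD (by simp [Derivation.commutator_apply, hD, hU])

lemma exists_casimir_eq_C (h : IsSl2Pair D U) (hnt : ¬(D = 0 ∧ U = 0)) :
    ∃ a, area D U ^ 2 - area ⁅D, U⁆ D * area ⁅D, U⁆ U = C a := by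
  refine h.exists_eq_C hnt ?_ ?_
  · rw [map_sub, sq, D.leibniz, D.leibniz, h.left_area, h.left_area_lie_left,
      h.left_area_lie_right]
    simp only [smul_eq_mul]
    ring
  · rw [map_sub, sq, U.leibniz, U.leibniz, h.right_area, h.right_area_lie_left,
      h.right_area_lie_right]
    simp only [smul_eq_mul]
    ring

lemma weight_mul_comm (h : IsSl2Pair D U) (hnt : ¬(D = 0 ∧ U = 0))
    {f g m n : MvPolynomial (Fin 2) R}
    (hf : D f = 0) (hg : D g = 0) (hfm : ⁅D, U⁆ f = m * f) (hgn : ⁅D, U⁆ g = n * g)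
    (V : Derivation R (MvPolynomial (Fin 2) R) (MvPolynomial (Fin 2) R)) :
    m * f * V g = n * g * V f := by
  have h1 := area_mul_sub_area_mul ⁅D, U⁆ D V f
  have h2 := area_mul_sub_area_mul ⁅D, U⁆ D V g
  rw [hf, hfm] at h1
  rw [hg, hgn] at h2
  refine mul_left_cancel₀ (h.area_lie_left_ne_zero hnt) ?_
  linear_combination m * f * h2 - n * g * h1

lemma false_of_mul_eq_area_sub_C (h : IsSl2Pair D U) (hnt : ¬(D = 0 ∧ U = 0)) {c : R}
    (hc : c ≠ 0)
    (hcas : area D U ^ 2 - area ⁅D, U⁆ D * area ⁅D, U⁆ U = C (c ^ 2))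
    {f g : MvPolynomial (Fin 2) R} (hfg : f * g = area D U - C c)
    (hf : D f = 0) (hf' : U f ≠ 0) : False := by
  have hp := h.area_lie_left_ne_zero hnt
  have hDfg : f * D g = -area ⁅D, U⁆ D := by
    have := congrArg D hfg
    rw [D.leibniz, hf, map_sub, h.left_area, derivation_C] at this
    simpa using this
  have hDg : D g ≠ 0 := fun h0 => hp (by simpa [h0] using hDfg.symm)
  have hUfg : U (f * g) = -area ⁅D, U⁆ U := by
    rw [hfg, map_sub, h.right_area, derivation_C, sub_zero]
  have hf0 : f ≠ 0 := by
    rintro rfl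
    simp at hf'
  have hg0 : g ≠ 0 := by
    rintro rfl
    simp at hDg
  obtain ⟨hUUf, hUg⟩ : U (U f) = 0 ∧ U g = 0 := by
    have h2 : U^[1 + 1] (f * g) = 0 := by
      change U (U (f * g)) = 0
      rw [hUfg, map_neg, h.right_area_lie_right, neg_zero]
    obtain ⟨m, l, hml, -, hm, hl⟩ :=
      h.isLND_right.exists_of_iterate_mul_eq_zero (mul_ne_zero hf0 hg0) h2
    have hm0 : m ≠ 0 := by
      rintro rfl
      exact hf' hm
    obtain ⟨rfl, rfl⟩ : m = 1 ∧ l = 0 := by omega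
    exact ⟨hm, hl⟩
  have hDDg : D (D g) = 0 := by
    have := congrArg D hDfg
    rw [D.leibniz, hf, map_neg, h.left_area_lie_left] at this
    simpa [hf0] using this
  obtain ⟨a, ha⟩ : ∃ a, ⁅D, U⁆ f - f = C a := by
    refine h.exists_eq_C hnt ?_ ?_
    · rw [map_sub, h.left_weight, hf]
      simp
    · have h1 := left_right D U (U f)
      have h2 := left_right D U f
      have h3 := h.right_weight f
      rw [hUUf, map_zero, h2, hf, map_zero, zero_add] at h1
      have : 2 * (U (⁅D, U⁆ f) - U f) = 0 := by linear_combination h3 - h1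
      simpa [map_sub] using this
  have hUDg : U (D g) = -⁅D, U⁆ g := by
    have := left_right D U g
    rw [hUg, map_zero] at this
    linear_combination -this
  have hHDg : ⁅D, U⁆ (D g) = D g := by
    have h1 := left_right D U (D g)
    rw [hDDg, map_zero, hUDg, map_neg, h.left_weight] at h1
    have : 2 * (⁅D, U⁆ (D g) - D g) = 0 := by linear_combination -h1
    simpa [sub_eq_zero] using this
  obtain ⟨b, hb⟩ : ∃ b, ⁅D, U⁆ g + g = C b := by
    refine h.exists_eq_C hnt ?_ ?_
    · rw [map_add, h.left_weight, hHDg]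
      ring
    · rw [map_add, h.right_weight, hUg]
      simp
  have hab : C a * g + C b * f = 0 := by
    have : ⁅D, U⁆ (f * g) = ⁅D, U⁆ (area D U - C c) := by rw [hfg]
    rw [Derivation.leibniz, map_sub, h.lie_area, derivation_C, smul_eq_mul, smul_eq_mul] at this
    linear_combination this - g * ha - f * hb
  have ha0 : a = 0 := by
    have := congrArg D hab
    simpa [hf, hDg] using this
  have hb0 : b = 0 := by simpa [ha0, hf0] using hab
  rw [ha0, C_0, sub_eq_zero] at ha
  rw [hb0, C_0] at hb
  have hcomm := h.weight_mul_comm hnt hf hDDg (m := 1) (n := 1) (by rw [ha, one_mul])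
    (by rw [hHDg, one_mul]) U
  rw [U.leibniz, hUg, smul_zero, zero_add, smul_eq_mul] at hUfg
  have hfac : (f * g) * (area D U + C c - D g * U f) = 0 := by
    rw [C_pow] at hcas
    linear_combination (area D U + C c) * hfg + hcas + area ⁅D, U⁆ D * hUfg - g * U f * hDfg
  have hfac' := (mul_eq_zero.1 hfac).resolve_left (mul_ne_zero hf0 hg0)
  have : (2 : MvPolynomial (Fin 2) R) * C c = 0 := by
    linear_combination hfac' + hfg - f * hb - hcomm + f * hUDg
  simp [hc] at this

lemma casimir_eq_zero_of_eq_C_sq {L : Type*} [Field L] [CharZero L]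
    {D U : Derivation L (MvPolynomial (Fin 2) L) (MvPolynomial (Fin 2) L)}
    (h : IsSl2Pair D U) (hnt : ¬(D = 0 ∧ U = 0)) {c : L}
    (hcas : area D U ^ 2 - area ⁅D, U⁆ D * area ⁅D, U⁆ U = C (c ^ 2)) : c = 0 := by
  by_contra hc
  have hp := h.area_lie_left_ne_zero hnt
  have hpu : ¬IsUnit (area ⁅D, U⁆ D) := by
    intro hu
    obtain ⟨a, ha, he⟩ := isUnit_iff_eq_C_of_isReduced.1 hu
    have := h.lie_area_lie_left
    rw [he, derivation_C] at this
    simp [ha.ne_zero] at this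
  obtain ⟨π, hπ, hdvd⟩ := WfDvdMonoid.exists_irreducible_factor hpu hp
  have hπD : D π = 0 := by
    obtain ⟨t, ht⟩ := hdvd
    exact h.isLND_left.eq_zero_of_mul (ht ▸ hp) (ht ▸ h.left_area_lie_left)
  have hπU : U π ≠ 0 := by
    intro h0
    obtain ⟨a, rfl⟩ := h.exists_eq_C hnt hπD h0
    have ha : a ≠ 0 := by
      rintro rfl
      exact hπ.ne_zero C_0
    exact hπ.not_isUnit ((isUnit_iff_ne_zero.2 ha).map C)
  have hmul : π ∣ (area D U - C c) * (area D U - C (-c)) := by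
    have : (area D U - C c) * (area D U - C (-c)) = area ⁅D, U⁆ D * area ⁅D, U⁆ U := by
      rw [C_pow] at hcas
      rw [C_neg]
      linear_combination hcas
    rw [this]
    exact hdvd.mul_right _
  rcases hπ.prime.dvd_or_dvd hmul with ⟨t, ht⟩ | ⟨t, ht⟩
  · exact h.false_of_mul_eq_area_sub_C hnt hc hcas ht.symm hπD hπU
  · exact h.false_of_mul_eq_area_sub_C hnt (neg_ne_zero.2 hc) (by rwa [neg_sq]) ht.symm hπD hπU

lemma casimir_eq_zero (h : IsSl2Pair D U) (hnt : ¬(D = 0 ∧ U = 0)) :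
    area D U ^ 2 = area ⁅D, U⁆ D * area ⁅D, U⁆ U := by
  obtain ⟨a, ha⟩ := h.exists_casimir_eq_C hnt
  let K := FractionRing R
  let L := AlgebraicClosure K
  have hinj : Function.Injective (algebraMap R L) := by
    rw [IsScalarTower.algebraMap_eq R K L]
    exact (algebraMap K L).injective.comp (IsFractionRing.injective R K)
  have : CharZero L := charZero_of_injective_algebraMap hinj
  have hzero : ∀ V : Derivation R (MvPolynomial (Fin 2) R) (MvPolynomial (Fin 2) R),
      baseChange L V = 0 → V = 0 := by
    intro V hV
    ext1 i
    have := baseChange_map (L := L) V (X i)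
    rw [hV, Derivation.zero_apply] at this
    exact map_injective _ hinj (by rw [← this]; simp)
  obtain ⟨c, hc⟩ := IsAlgClosed.exists_pow_nat_eq (algebraMap R L a) (n := 2) (by norm_num)
  have hc0 := (h.isSl2Pair_baseChange L).casimir_eq_zero_of_eq_C_sq
    (fun h0 => hnt ⟨hzero D h0.1, hzero U h0.2⟩) (c := c) (by
      rw [lie_baseChange, area_baseChange, area_baseChange, area_baseChange, hc, ← map_C, ← ha]
      simp)
  have ha0 : a = 0 := by
    refine hinj ?_
    rw [← hc, hc0, map_zero]
    simp
  rw [ha0, C_0] at ha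
  exact sub_eq_zero.1 ha

section WeightOne

variable [UniqueFactorizationMonoid R]

lemma exists_primitive_weight_one (h : IsSl2Pair D U) (hnt : ¬(D = 0 ∧ U = 0)) :
    ∃ P : MvPolynomial (Fin 2) R, P ≠ 0 ∧ D P = 0 ∧ ⁅D, U⁆ P = P ∧
      ∀ b : R, Prime b → ¬ C b ∣ P := by
  have hp := h.area_lie_left_ne_zero hnt
  have hs : area ⁅D, U⁆ U ≠ 0 := by
    intro h0
    have hq := h.casimir_eq_zero hnt
    rw [h0, mul_zero] at hq
    have := h.left_area
    rw [pow_eq_zero_iff two_ne_zero |>.1 hq, map_zero] at this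
    exact hp (neg_eq_zero.1 this.symm)
  obtain ⟨r, ⟨a, rfl⟩, f, hf⟩ := exists_eq_mul_sq_of_mul_eq_sq
    (MonoidHom.mrange (C : R →+* MvPolynomial (Fin 2) R).toMonoidHom)
    (fun u hu => by
      obtain ⟨a, -, rfl⟩ := isUnit_iff_eq_C_of_isReduced.1 hu
      exact ⟨a, rfl⟩)
    _ _ _ hp (h.casimir_eq_zero hnt).symm (by
      rintro π - ⟨t, ht⟩ ⟨t', ht'⟩
      obtain ⟨a, rfl⟩ := h.exists_eq_C hnt
        (h.isLND_left.eq_zero_of_mul (ht ▸ hp) (ht ▸ h.left_area_lie_left))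
        (h.isLND_right.eq_zero_of_mul (ht' ▸ hs) (ht' ▸ h.right_area_lie_right))
      exact ⟨a, rfl⟩)
  change _ = C a * f ^ 2 at hf
  have hf0 : f ≠ 0 := by
    rintro rfl
    simp [hp] at hf
  obtain ⟨b, P, hfP, hP⟩ := exists_eq_C_mul_of_forall_prime_not_dvd f hf0
  have hfac : area ⁅D, U⁆ D = P * (C a * C b * f) := by
    rw [hf]
    linear_combination C a * f * hfP
  have hsq : area ⁅D, U⁆ D = C (a * b ^ 2) * P ^ 2 := by
    rw [hf, hfP]
    simp only [C_mul, C_pow]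
    ring
  have hne : C (a * b ^ 2) * P ^ 2 ≠ 0 := hsq ▸ hp
  have hP0 : P ≠ 0 := left_ne_zero_of_mul (hfac ▸ hp)
  refine ⟨P, hP0, h.isLND_left.eq_zero_of_mul (hfac ▸ hp) (hfac ▸ h.left_area_lie_left), ?_, hP⟩
  have hH := h.lie_area_lie_left
  rw [hsq, C_mul', Derivation.map_smul, pow_two P, Derivation.leibniz, smul_eq_mul, smul_eq_C_mul,
    smul_eq_C_mul] at hH
  have : (2 * (C (a * b ^ 2) * P)) * (⁅D, U⁆ P - P) = 0 := by linear_combination hH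
  have h2 : 2 * (C (a * b ^ 2) * P) ≠ 0 :=
    mul_ne_zero two_ne_zero (mul_ne_zero (left_ne_zero_of_mul hne) hP0)
  exact sub_eq_zero.1 ((mul_eq_zero.1 this).resolve_left h2)

variable {P : MvPolynomial (Fin 2) R}

lemma right_weight_one {R B : Type*} [CommRing R] [CommRing B] [Algebra R B]
    {D U : Derivation R B B} (h : IsSl2Pair D U) {P : B} (hH : ⁅D, U⁆ P = P) :
    ⁅D, U⁆ (U P) = -U P := by
  have := h.right_weight P
  rw [hH] at this
  linear_combination -this

lemma right_right_eq_zero {R B : Type*} [CommRing R] [CommRing B] [Algebra R B] [Algebra ℚ R]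
    {D U : Derivation R B B} (h : IsSl2Pair D U) {P : B} (hD : D P = 0) (hH : ⁅D, U⁆ P = P) :
    U (U P) = 0 := by
  have hQ := h.right_weight_one hH
  have := h.mem_of_weight_neg (N := fun _ => ⊥) (by simp) (by simp) (d := -3) (by norm_num)
    (x := U (U P)) ?_ ?_
  · simpa using this
  · have := h.right_weight (U P)
    rw [hQ, map_neg] at this
    simp only [zsmul_eq_mul]
    push_cast
    linear_combination -this
  · rw [left_right D U (U P), left_right D U P, hD, map_zero, zero_add, hH, hQ, add_neg_cancel]
    exact Submodule.zero_mem _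

lemma isRelPrime_right (h : IsSl2Pair D U) (hnt : ¬(D = 0 ∧ U = 0)) (hP0 : P ≠ 0)
    (hD : D P = 0) (hDQ : D (U P) = P) (hUQ : U (U P) = 0)
    (hP : ∀ b : R, Prime b → ¬ C b ∣ P) : IsRelPrime P (U P) := by
  have hQ0 : U P ≠ 0 := fun h0 => hP0 (by rw [← hDQ, h0, map_zero])
  refine WfDvdMonoid.isRelPrime_of_no_irreducible_factors (fun h0 => hP0 h0.1) ?_
  rintro π hπ ⟨t, ht⟩ ⟨t', ht'⟩
  obtain ⟨b, rfl⟩ := h.exists_eq_C hnt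
    (h.isLND_left.eq_zero_of_mul (ht ▸ hP0) (ht ▸ hD))
    (h.isLND_right.eq_zero_of_mul (ht' ▸ hQ0) (ht' ▸ hUQ))
  exact hP b ((prime_C_iff (Fin 2)).1 hπ.prime) ⟨t, ht⟩

lemma exists_eq_C_mul_pow [Algebra ℚ R] (h : IsSl2Pair D U) (hnt : ¬(D = 0 ∧ U = 0)) (hP0 : P ≠ 0)
    (hD : D P = 0) (hH : ⁅D, U⁆ P = P) (hrel : IsRelPrime P (U P)) (d : ℕ) :
    ∀ f : MvPolynomial (Fin 2) R, D f = 0 → ⁅D, U⁆ f = d * f → ∃ a, f = C a * P ^ d := by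
  induction d with
  | zero =>
    intro f hDf hHf
    simpa using h.exists_eq_C_of_left_eq_zero hnt hDf (by simpa using hHf)
  | succ d ih =>
    intro f hDf hHf
    have hcomm := h.weight_mul_comm hnt hDf hD hHf (hH.trans (one_mul P).symm) U
    have hunit : IsUnit (((d + 1 : ℕ) : MvPolynomial (Fin 2) R)) := by
      rw [← map_natCast ((C : R →+* MvPolynomial (Fin 2) R).comp (algebraMap ℚ R))]
      exact (isUnit_iff_ne_zero.2 (Nat.cast_ne_zero.2 d.succ_ne_zero)).map _
    have hdvd : P ∣ ((d + 1 : ℕ) : MvPolynomial (Fin 2) R) * f :=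
      hrel.dvd_of_dvd_mul_right ⟨U f, by rw [hcomm, one_mul]⟩
    obtain ⟨g, rfl⟩ := hunit.dvd_mul_left.1 hdvd
    rw [D.leibniz, hD, smul_zero, add_zero, smul_eq_mul] at hDf
    rw [Derivation.leibniz, hH, smul_eq_mul, smul_eq_mul] at hHf
    obtain ⟨a, rfl⟩ := ih g ((mul_eq_zero.1 hDf).resolve_left hP0)
      (mul_left_cancel₀ hP0 (by push_cast at hHf; linear_combination hHf))
    exact ⟨a, by ring⟩

end WeightOne

section Generators

variable {R B : Type*} [CommRing R] [CommRing B] [Algebra R B] {D U : Derivation R B B}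

/-- The span of the monomials `P ^ i * Q ^ j` of weight `d`, where `P` has weight `1` and
`Q` has weight `-1`. -/
def weightSpan (R : Type*) {B : Type*} [CommRing R] [CommRing B] [Algebra R B] (P Q : B) (d : ℤ) :
    Submodule R B :=
  Submodule.span R {x | ∃ i j : ℕ, (i : ℤ) - j = d ∧ x = P ^ i * Q ^ j}

lemma pow_mul_pow_mem_weightSpan (P Q : B) (i j : ℕ) {d : ℤ} (h : (i : ℤ) - j = d) :
    P ^ i * Q ^ j ∈ weightSpan R P Q d :=
  Submodule.subset_span ⟨i, j, h, rfl⟩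

lemma weightSpan_le_adjoin (P Q : B) (d : ℤ) :
    weightSpan R P Q d ≤ Subalgebra.toSubmodule (Algebra.adjoin R {P, Q}) := by
  refine Submodule.span_le.2 ?_
  rintro _ ⟨i, j, -, rfl⟩
  exact Subalgebra.mul_mem _ (pow_mem (Algebra.subset_adjoin (by simp)) i)
    (pow_mem (Algebra.subset_adjoin (by simp)) j)

lemma left_mem_weightSpan {P Q : B} (hDP : D P = 0) (hDQ : D Q = P) (d : ℤ) :
    ∀ x ∈ weightSpan R P Q d, D x ∈ weightSpan R P Q (d + 2) := by
  refine fun x hx => Submodule.span_le (p := (weightSpan R P Q (d + 2)).comap D.toLinearMap).2 ?_ hx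
  rintro _ ⟨i, j, rfl, rfl⟩
  change D (P ^ i * Q ^ j) ∈ weightSpan R P Q _
  rcases j with _ | j
  · simp [D.leibniz_pow, hDP]
  · have : D (P ^ i * Q ^ (j + 1)) = (j + 1) • (P ^ (i + 1) * Q ^ j) := by
      rw [D.leibniz, D.leibniz_pow, D.leibniz_pow, hDP, hDQ]
      simp only [smul_eq_mul, nsmul_eq_mul, Nat.add_sub_cancel]
      push_cast
      ring
    rw [this]
    exact Submodule.smul_of_tower_mem _ _
      (pow_mul_pow_mem_weightSpan P Q _ _ (by push_cast; ring))

lemma right_mem_weightSpan {P Q : B} (hUP : U P = Q) (hUQ : U Q = 0) (d : ℤ) :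
    ∀ x ∈ weightSpan R P Q d, U x ∈ weightSpan R P Q (d - 2) := by
  refine fun x hx => Submodule.span_le (p := (weightSpan R P Q (d - 2)).comap U.toLinearMap).2 ?_ hx
  rintro _ ⟨i, j, rfl, rfl⟩
  change U (P ^ i * Q ^ j) ∈ weightSpan R P Q _
  rcases i with _ | i
  · simp [U.leibniz_pow, hUQ]
  · have : U (P ^ (i + 1) * Q ^ j) = (i + 1) • (P ^ i * Q ^ (j + 1)) := by
      rw [U.leibniz, U.leibniz_pow, U.leibniz_pow, hUP, hUQ]
      simp only [smul_eq_mul, nsmul_eq_mul, Nat.add_sub_cancel]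
      push_cast
      ring
    rw [this]
    exact Submodule.smul_of_tower_mem _ _
      (pow_mul_pow_mem_weightSpan P Q _ _ (by push_cast; ring))

lemma weight_of_mem_weightSpan {H : Derivation R B B} {P Q : B} (hP : H P = P) (hQ : H Q = -Q)
    {d : ℤ} {x : B} (hx : x ∈ weightSpan R P Q d) : H x = d • x := by
  have hpow : ∀ n : ℕ, H (P ^ n) = n * P ^ n ∧ H (Q ^ n) = -(n * Q ^ n) := by
    intro n
    induction n with
    | zero => simp
    | succ n ih =>
      simp only [pow_succ, H.leibniz, hP, hQ, ih, smul_eq_mul]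
      push_cast
      constructor <;> ring
  refine Submodule.span_le (p := LinearMap.eqLocus H.toLinearMap
    (d • (LinearMap.id : B →ₗ[R] B))).2 ?_ hx
  rintro _ ⟨i, j, rfl, rfl⟩
  change H (P ^ i * Q ^ j) = ((i : ℤ) - j) • (P ^ i * Q ^ j)
  simp only [H.leibniz, hpow, smul_eq_mul, zsmul_eq_mul]
  push_cast
  ring

lemma exists_left_eq_of_mem_weightSpan [Algebra ℚ R] {P Q : B} (hDP : D P = 0) (hDQ : D Q = P)
    {d : ℤ} (hd : 0 ≤ d) {y : B} (hy : y ∈ weightSpan R P Q (d + 2)) :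
    ∃ z ∈ weightSpan R P Q d, D z = y := by
  refine Submodule.span_le (p := (weightSpan R P Q d).map D.toLinearMap).2 ?_ hy
  rintro _ ⟨i, j, hij, rfl⟩
  obtain ⟨i, rfl⟩ := Nat.exists_eq_succ_of_ne_zero (n := i) (by omega)
  refine ⟨algebraMap ℚ R ((j + 1 : ℕ) : ℚ)⁻¹ • (P ^ i * Q ^ (j + 1)), Submodule.smul_mem _ _
    (pow_mul_pow_mem_weightSpan P Q _ _ (by push_cast at hij ⊢; linarith)), ?_⟩
  have : D (P ^ i * Q ^ (j + 1)) = ((j + 1 : ℕ) : R) • (P ^ (i + 1) * Q ^ j) := by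
    rw [D.leibniz, D.leibniz_pow, D.leibniz_pow, hDP, hDQ,
      Nat.cast_smul_eq_nsmul]
    simp only [smul_eq_mul, nsmul_eq_mul, Nat.add_sub_cancel]
    push_cast
    ring
  change D (_ • _) = _
  rw [D.map_smul, this, smul_smul, ← map_natCast (algebraMap ℚ R), ← map_mul,
    inv_mul_cancel₀ (Nat.cast_ne_zero.2 j.succ_ne_zero), map_one, one_smul]

lemma mem_weightSpan [Algebra ℚ R] (h : IsSl2Pair D U) {P : B}
    (hDP : D P = 0) (hH : ⁅D, U⁆ P = P) (hDQ : D (U P) = P) (hUQ : U (U P) = 0)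
    (hker : ∀ (d : ℕ) (f : B), D f = 0 → ⁅D, U⁆ f = d * f → f ∈ weightSpan R P (U P) d) (n : ℕ) :
    ∀ (d : ℤ) (b : B), ⁅D, U⁆ b = d • b → D^[n] b = 0 → b ∈ weightSpan R P (U P) d := by
  induction n with
  | zero =>
    rintro d b - hb
    exact (show b = 0 from hb) ▸ Submodule.zero_mem _
  | succ n ih =>
    intro d b hb hn
    have hDb : D b ∈ weightSpan R P (U P) (d + 2) := by
      refine ih _ _ ?_ hn
      have := h.left_weight b
      rw [hb, map_zsmul] at this
      simp only [zsmul_eq_mul] at this ⊢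
      push_cast
      linear_combination -this
    rcases lt_or_ge d 0 with hd | hd
    · exact h.mem_of_weight_neg (left_mem_weightSpan hDP hDQ)
        (right_mem_weightSpan rfl hUQ) hd hb hDb
    · obtain ⟨z, hz, hDz⟩ := exists_left_eq_of_mem_weightSpan hDP hDQ hd hDb
      have hHz := weight_of_mem_weightSpan hH (h.right_weight_one hH) hz
      lift d to ℕ using hd
      have := hker d (b - z) (by rw [map_sub, hDz, sub_self])
        (by rw [map_sub, hb, hHz]; simp [mul_sub])
      simpa using Submodule.add_mem _ this hz

lemma adjoin_eq_top [Algebra ℚ R] (h : IsSl2Pair D U) (htop : (⨆ d : ℤ, gradePiece D U d) = ⊤)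
    {P : B} (hDP : D P = 0) (hH : ⁅D, U⁆ P = P) (hDQ : D (U P) = P) (hUQ : U (U P) = 0)
    (hker : ∀ (d : ℕ) (f : B), D f = 0 → ⁅D, U⁆ f = d * f → f ∈ weightSpan R P (U P) d) :
    Algebra.adjoin R {P, U P} = ⊤ := by
  rw [← Algebra.toSubmodule_eq_top, eq_top_iff, ← htop]
  refine iSup_le fun d b hb => weightSpan_le_adjoin P (U P) d ?_
  obtain ⟨n, hn⟩ := (isLND_iff D).1 h.isLND_left b
  exact h.mem_weightSpan hDP hH hDQ hUQ hker n d b (sub_eq_zero.1 hb) hn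

end Generators

end IsSl2Pair

/-- for an affine UFD `R` over `k` and `B = R[X,Y]`, every nontrivial
fundamental pair `(D,U)` of locally nilpotent `R`-derivations of `B` is conjugate over
`R` to `(X∂_Y, Y∂_X)`; equivalently, there are `P, Q` with `B = R[P,Q]`, `DP = 0`,
`DQ = P`, `UQ = 0`, `UP = Q`. -/
theorem stmt_15 {k R : Type*} [Field k] [CharZero k] [CommRing R] [IsDomain R]
    [UniqueFactorizationMonoid R] [Algebra k R] [Algebra.FiniteType k R]
    (D U : Derivation R (MvPolynomial (Fin 2) R) (MvPolynomial (Fin 2) R))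
    (hDU : IsFundamentalPair D U) (hnt : ¬(D = 0 ∧ U = 0)) :
    ∃ P Q : MvPolynomial (Fin 2) R,
      Algebra.adjoin R {P, Q} = ⊤ ∧ D P = 0 ∧ D Q = P ∧ U Q = 0 ∧ U P = Q := by
  have : CharZero R := charZero_of_injective_algebraMap (algebraMap k R).injective
  let : Algebra ℚ R := ((algebraMap k R).comp (algebraMap ℚ k)).toAlgebra
  have h : IsSl2Pair D U := ⟨hDU.1, hDU.2.1, hDU.2.2.1, hDU.2.2.2.1⟩
  obtain ⟨P, hP0, hDP, hH, hP⟩ := h.exists_primitive_weight_one hnt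
  have hDQ : D (U P) = P := by rw [IsSl2Pair.left_right, hDP, map_zero, zero_add, hH]
  have hUQ := h.right_right_eq_zero hDP hH
  refine ⟨P, U P, h.adjoin_eq_top hDU.2.2.2.2 hDP hH hDQ hUQ fun d f hDf hHf => ?_,
    hDP, hDQ, hUQ, rfl⟩
  obtain ⟨a, rfl⟩ := h.exists_eq_C_mul_pow hnt hP0 hDP hH
    (h.isRelPrime_right hnt hP0 hDP hDQ hUQ hP) d f hDf hHf
  rw [← MvPolynomial.smul_eq_C_mul]
  simpa using Submodule.smul_mem _ a
    (IsSl2Pair.pow_mul_pow_mem_weightSpan (R := R) P (U P) d 0 (by simp))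
end
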